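/- (Filtered Bipolar Theorem) Let C be a far-reaching subset of S₁. Then the process bipolar C^×× = (C^×)^× is the smallest closed (under Fatou convergence), fork-convex and (process) solid subset of S₁ containing C; that is, C^×× is Fatou-closed, fork-convex, solid and contains C, and it is contained in every Fatou-closed, fork-convex, solid subset of S₁ containing C. -/

import Mathlib

open MeasureTheory Filter Set
open scoped NNReal ENNReal

variable {Ω : Type*}

/-- A real function is càdlàg on `[0,T]`: right-continuous at every `t ∈ [0,T)` and
with left limits at every `t ∈ (0,T]`. -/
def CadlagOn (T : ℝ) (f : ℝ → ℝ) : Prop :=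
  (∀ t ∈ Set.Ico (0 : ℝ) T, Filter.Tendsto f (nhdsWithin t (Set.Ioi t)) (nhds (f t))) ∧
  (∀ t ∈ Set.Ioc (0 : ℝ) T, ∃ L : ℝ, Filter.Tendsto f (nhdsWithin t (Set.Iio t)) (nhds L))

/-- A positive process on `[0,T]`: adapted, nonnegative, with càdlàg paths. -/
def PosProc {m0 : MeasurableSpace Ω} (μ : Measure Ω) (T : ℝ)
    (ℱ : Filtration ℝ m0) (X : ℝ → Ω → ℝ) : Prop :=
  (∀ t ∈ Set.Icc (0 : ℝ) T, StronglyMeasurable[ℱ t] (X t)) ∧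
  (∀ᵐ ω ∂μ, ∀ t ∈ Set.Icc (0 : ℝ) T, 0 ≤ X t ω) ∧
  (∀ᵐ ω ∂μ, CadlagOn T (fun t => X t ω))

/-- A nonnegative càdlàg supermartingale on `[0,T]`. -/
def SuperMG {m0 : MeasurableSpace Ω} (μ : Measure Ω) (T : ℝ)
    (ℱ : Filtration ℝ m0) (X : ℝ → Ω → ℝ) : Prop :=
  PosProc μ T ℱ X ∧ (∀ t ∈ Set.Icc (0 : ℝ) T, Integrable (X t) μ) ∧
  ∀ s t : ℝ, s ∈ Set.Icc (0 : ℝ) T → t ∈ Set.Icc (0 : ℝ) T → s ≤ t →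
    μ[X t | ℱ s] ≤ᵐ[μ] X s

/-- Membership in `S₁`: a nonnegative càdlàg supermartingale with `Y₀ ≤ 1`. -/
def S1mem {m0 : MeasurableSpace Ω} (μ : Measure Ω) (T : ℝ)
    (ℱ : Filtration ℝ m0) (X : ℝ → Ω → ℝ) : Prop :=
  SuperMG μ T ℱ X ∧ ∀ᵐ ω ∂μ, X 0 ω ≤ 1

/-- Membership in `V`: a nonincreasing positive process with `B₀ ≤ 1`. -/
def Vmem {m0 : MeasurableSpace Ω} (μ : Measure Ω) (T : ℝ)
    (ℱ : Filtration ℝ m0) (B : ℝ → Ω → ℝ) : Prop :=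
  PosProc μ T ℱ B ∧
  (∀ᵐ ω ∂μ, ∀ s ∈ Set.Icc (0 : ℝ) T, ∀ t ∈ Set.Icc (0 : ℝ) T, s ≤ t → B t ω ≤ B s ω) ∧
  (∀ᵐ ω ∂μ, B 0 ω ≤ 1)

/-- The process polar `C^×`: all positive processes `Y` such that `XY` is a
supermartingale with `X₀Y₀ ≤ 1` for every `X ∈ C`. -/
def procPolar {m0 : MeasurableSpace Ω} (μ : Measure Ω) (T : ℝ)
    (ℱ : Filtration ℝ m0) (C : Set (ℝ → Ω → ℝ)) : Set (ℝ → Ω → ℝ) :=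
  {Y | PosProc μ T ℱ Y ∧ ∀ X ∈ C,
    SuperMG μ T ℱ (fun t ω => X t ω * Y t ω) ∧ ∀ᵐ ω ∂μ, X 0 ω * Y 0 ω ≤ 1}

/-- (Process) solidity: stability under multiplication by elements of `V`. -/
def ProcSolid {m0 : MeasurableSpace Ω} (μ : Measure Ω) (T : ℝ)
    (ℱ : Filtration ℝ m0) (C : Set (ℝ → Ω → ℝ)) : Prop :=
  ∀ Y ∈ C, ∀ B : ℝ → Ω → ℝ, Vmem μ T ℱ B → (fun t ω => Y t ω * B t ω) ∈ C

/-- Fork-convexity (with the convention `0/0 = 0`, which holds for Lean division). -/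
def ForkConvex {m0 : MeasurableSpace Ω} (μ : Measure Ω) (T : ℝ)
    (ℱ : Filtration ℝ m0) (C : Set (ℝ → Ω → ℝ)) : Prop :=
  ∀ s ∈ Set.Icc (0 : ℝ) T, ∀ h : Ω → ℝ, StronglyMeasurable[ℱ s] h →
    (∀ ω, 0 ≤ h ω) → (∀ ω, h ω ≤ 1) →
    ∀ Y1 ∈ C, ∀ Y2 ∈ C, ∀ Y3 ∈ C,
      (fun t ω => if t < s then Y1 t ω
        else Y1 s ω * (h ω * (Y2 t ω / Y2 s ω) + (1 - h ω) * (Y3 t ω / Y3 s ω))) ∈ C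

/-- Fatou convergence of a sequence of positive processes. -/
def FatouConv {m0 : MeasurableSpace Ω} (μ : Measure Ω) (T : ℝ) (Yn : ℕ → ℝ → Ω → ℝ) (Y : ℝ → Ω → ℝ) : Prop :=
  ∃ T' : Set ℝ, T'.Countable ∧ T' ⊆ Set.Icc 0 T ∧ Set.Icc (0 : ℝ) T ⊆ closure T' ∧
    ∀ᵐ ω ∂μ,
      (∀ t ∈ Set.Ico (0 : ℝ) T,
        (ENNReal.ofReal (Y t ω)
            = Filter.liminf
                (fun s => Filter.liminf (fun n => ENNReal.ofReal (Yn n s ω)) Filter.atTop)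
                (nhdsWithin t (Set.Ioi t ∩ T')) ∧
         ENNReal.ofReal (Y t ω)
            = Filter.limsup
                (fun s => Filter.limsup (fun n => ENNReal.ofReal (Yn n s ω)) Filter.atTop)
                (nhdsWithin t (Set.Ioi t ∩ T')))) ∧
      Filter.Tendsto (fun n => Yn n T ω) Filter.atTop (nhds (Y T ω))

/-- Closedness under Fatou convergence. -/
def FatouClosed {m0 : MeasurableSpace Ω} (μ : Measure Ω) (T : ℝ)
    (ℱ : Filtration ℝ m0) (C : Set (ℝ → Ω → ℝ)) : Prop :=
  ∀ (Yn : ℕ → ℝ → Ω → ℝ) (Y : ℝ → Ω → ℝ), (∀ n, Yn n ∈ C) → PosProc μ T ℱ Y →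
    FatouConv μ T Yn Y → Y ∈ C

/-- A set of processes is far-reaching if it has an element with `Y_T > 0` a.s. -/
def FarReaching {m0 : MeasurableSpace Ω} (μ : Measure Ω) (T : ℝ) (C : Set (ℝ → Ω → ℝ)) : Prop :=
  ∃ Y ∈ C, ∀ᵐ ω ∂μ, 0 < Y T ω

/-- The solid, fork-convex hull of `C`: the smallest (process) solid and fork-convex
subset of `S₁` containing `C`. -/
def solidForkHull {m0 : MeasurableSpace Ω} (μ : Measure Ω) (T : ℝ)
    (ℱ : Filtration ℝ m0) (C : Set (ℝ → Ω → ℝ)) : Set (ℝ → Ω → ℝ) :=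
  ⋂₀ {D | D ⊆ {X | S1mem μ T ℱ X} ∧ ProcSolid μ T ℱ D ∧ ForkConvex μ T ℱ D ∧ C ⊆ D}

/-- Extended (`[0,∞]`-valued) conditional expectation of a (nonnegative) function,
defined as the supremum of the conditional expectations of its truncations. -/
noncomputable def econd {mΩ : MeasurableSpace Ω} (μ : Measure Ω)
    (m : MeasurableSpace Ω) (f : Ω → ℝ) : Ω → ℝ≥0∞ :=
  fun ω => ⨆ n : ℕ, ENNReal.ofReal ((μ[fun ω' => min (f ω') n | m]) ω)


open scoped Topology

/-- Weak form of `E[b | m] ≤ a` for `[0,∞]`-valued functions. -/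
def CondLE {m0 : MeasurableSpace Ω} (μ : Measure Ω) (m : MeasurableSpace Ω)
    (b a : Ω → ℝ≥0∞) : Prop :=
  ∀ φ : Ω → ℝ≥0∞, Measurable[m] φ → ∫⁻ ω, φ ω * b ω ∂μ ≤ ∫⁻ ω, φ ω * a ω ∂μ

section CondLE

variable {m m' m0 : MeasurableSpace Ω} {μ : Measure Ω} {a b c : Ω → ℝ≥0∞}

lemma condLE_of_forall_set (hm : m ≤ m0) (ha : Measurable[m0] a) (hb : Measurable[m0] b)
    (h : ∀ A, MeasurableSet[m] A → ∫⁻ ω in A, b ω ∂μ ≤ ∫⁻ ω in A, a ω ∂μ) : CondLE μ m b a := by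
  intro φ hφ
  have key : (μ.withDensity b).trim hm ≤ (μ.withDensity a).trim hm := by
    refine Measure.le_iff.2 fun s hs => ?_
    rw [trim_measurableSet_eq hm hs, trim_measurableSet_eq hm hs,
      withDensity_apply _ (hm s hs), withDensity_apply _ (hm s hs)]
    exact h s hs
  have h2 : ∀ f : Ω → ℝ≥0∞, Measurable[m0] f →
      ∫⁻ ω, φ ω * f ω ∂μ = ∫⁻ ω, φ ω ∂(μ.withDensity f).trim hm := by
    intro f hf
    rw [lintegral_trim hm hφ, lintegral_withDensity_eq_lintegral_mul _ hf (hφ.mono hm le_rfl)]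
    simp [mul_comm]
  rw [h2 b hb, h2 a ha]
  exact lintegral_mono' key le_rfl

lemma CondLE.setLIntegral_le (h : CondLE μ m b a) (hm : m ≤ m0) {A : Set Ω}
    (hA : MeasurableSet[m] A) : ∫⁻ ω in A, b ω ∂μ ≤ ∫⁻ ω in A, a ω ∂μ := by
  have hφ : Measurable[m] (A.indicator fun _ => (1 : ℝ≥0∞)) :=
    Measurable.indicator (m := m) measurable_const hA
  have e : ∀ f : Ω → ℝ≥0∞, ∫⁻ ω in A, f ω ∂μ = ∫⁻ ω, A.indicator (fun _ => 1) ω * f ω ∂μ := by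
    intro f
    rw [← lintegral_indicator (hm A hA)]
    congr 1 with ω
    by_cases hω : ω ∈ A <;> simp [hω]
  rw [e, e]
  exact h _ hφ

lemma CondLE.lintegral_le (h : CondLE μ m b a) : ∫⁻ ω, b ω ∂μ ≤ ∫⁻ ω, a ω ∂μ := by
  simpa using h (fun _ => 1) measurable_const

lemma CondLE.trans (h : CondLE μ m' c b) (h' : CondLE μ m b a) (hm : m ≤ m') :
    CondLE μ m c a :=
  fun φ hφ => (h φ (hφ.mono hm le_rfl)).trans (h' φ hφ)

lemma condLE_of_ae_le (h : b ≤ᵐ[μ] a) : CondLE μ m b a := fun _ _ =>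
  lintegral_mono_ae (by filter_upwards [h] with ω hω; gcongr)

lemma CondLE.trans_ae (h : CondLE μ m c b) (h' : b ≤ᵐ[μ] a) : CondLE μ m c a :=
  fun φ hφ => (h φ hφ).trans (condLE_of_ae_le (m := m) h' φ hφ)

lemma CondLE.ae_trans (h : c ≤ᵐ[μ] b) (h' : CondLE μ m b a) : CondLE μ m c a :=
  fun φ hφ => (condLE_of_ae_le (m := m) h φ hφ).trans (h' φ hφ)

lemma CondLE.mul (h : CondLE μ m b a) {ψ : Ω → ℝ≥0∞} (hψ : Measurable[m] ψ) :
    CondLE μ m (fun ω => ψ ω * b ω) (fun ω => ψ ω * a ω) := by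
  intro φ hφ
  simpa [mul_assoc] using h (fun ω => φ ω * ψ ω) (hφ.mul hψ)

lemma CondLE.add {b' a' : Ω → ℝ≥0∞} (h : CondLE μ m b a) (h' : CondLE μ m b' a') (hm : m ≤ m0)
    (ha : Measurable[m0] a) (hb : Measurable[m0] b) :
    CondLE μ m (fun ω => b ω + b' ω) (fun ω => a ω + a' ω) := by
  intro φ hφ
  have hφ' := hφ.mono hm le_rfl
  simp only [mul_add]
  rw [lintegral_add_left (f := fun ω => φ ω * b ω) (hφ'.mul hb),
    lintegral_add_left (f := fun ω => φ ω * a ω) (hφ'.mul ha)]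
  exact add_le_add (h φ hφ) (h' φ hφ)

lemma CondLE.ae_le [IsFiniteMeasure μ] (h : CondLE μ m b a) (hm : m ≤ m0)
    (ha : Measurable[m] a) (hb : Measurable[m] b) : b ≤ᵐ[μ] a := by
  refine ae_of_ae_trim hm (ae_le_of_forall_setLIntegral_le_of_sigmaFinite hb fun s hs _ => ?_)
  rw [setLIntegral_trim hm hb hs, setLIntegral_trim hm ha hs]
  exact h.setLIntegral_le hm hs

lemma condLE_condLExp [IsFiniteMeasure μ] (hm : m ≤ m0) (hb : Measurable[m0] b) :
    CondLE μ m b (μ⁻[b|m]) :=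
  condLE_of_forall_set hm ((measurable_condLExp m μ b).mono hm le_rfl) hb fun _ hA =>
    (setLIntegral_condLExp hm μ b hA).ge

lemma condLExp_condLE [IsFiniteMeasure μ] (hm : m ≤ m0) (hb : Measurable[m0] b) :
    CondLE μ m (μ⁻[b|m]) b :=
  condLE_of_forall_set hm hb ((measurable_condLExp m μ b).mono hm le_rfl) fun _ hA =>
    (setLIntegral_condLExp hm μ b hA).le

lemma CondLE.condExp_le [IsFiniteMeasure μ] {f g : Ω → ℝ}
    (h : CondLE μ m (fun ω => ENNReal.ofReal (f ω)) (fun ω => ENNReal.ofReal (g ω))) (hm : m ≤ m0)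
    (hf : Integrable f μ) (hfm : Measurable f) (hf0 : 0 ≤ᵐ[μ] f) (hg : Measurable[m] g)
    (hg0 : 0 ≤ᵐ[μ] g) : μ[f|m] ≤ᵐ[μ] g := by
  have h1 : (μ⁻[fun ω => ENNReal.ofReal (f ω) | m]) ≤ᵐ[μ] fun ω => ENNReal.ofReal (g ω) :=
    ((condLExp_condLE (μ := μ) hm hfm.ennreal_ofReal).trans h le_rfl).ae_le hm
      hg.ennreal_ofReal (measurable_condLExp _ _ _)
  filter_upwards [h1, condLExp_ofReal m hf hf0, hg0] with ω h1 h2 h3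
  rw [h2] at h1
  exact (ENNReal.ofReal_le_ofReal_iff h3).1 h1

end CondLE

section Supermartingale

variable {m0 : MeasurableSpace Ω} {μ : Measure Ω} {T : ℝ} {ℱ : Filtration ℝ m0}
  {X Y : ℝ → Ω → ℝ}

lemma PosProc.measurable (h : PosProc μ T ℱ X) {t : ℝ} (ht : t ∈ Icc 0 T) :
    Measurable[ℱ t] (X t) := (h.1 t ht).measurable

lemma PosProc.measurable' (h : PosProc μ T ℱ X) {t : ℝ} (ht : t ∈ Icc 0 T) :
    Measurable (X t) := (h.measurable ht).mono (ℱ.le t) le_rfl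

lemma PosProc.nonneg (h : PosProc μ T ℱ X) {t : ℝ} (ht : t ∈ Icc 0 T) :
    ∀ᵐ ω ∂μ, 0 ≤ X t ω := by
  filter_upwards [h.2.1] with ω hω using hω t ht

lemma SuperMG.condLE [IsFiniteMeasure μ] (h : SuperMG μ T ℱ X) {s t : ℝ} (hs : s ∈ Icc 0 T)
    (ht : t ∈ Icc 0 T) (hst : s ≤ t) :
    CondLE μ (ℱ s) (fun ω => ENNReal.ofReal (X t ω)) (fun ω => ENNReal.ofReal (X s ω)) := by
  refine (condLE_condLExp (ℱ.le s) (h.1.measurable' ht).ennreal_ofReal).trans_ae ?_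
  filter_upwards [condLExp_ofReal (ℱ s) (h.2.1 t ht) (h.1.nonneg ht), h.2.2 s t hs ht hst]
    with ω h1 h2
  rw [h1]
  exact ENNReal.ofReal_le_ofReal h2

lemma superMG_of_condLE [IsFiniteMeasure μ] (hX : PosProc μ T ℱ X)
    (h0 : ∫⁻ ω, ENNReal.ofReal (X 0 ω) ∂μ ≠ ∞)
    (h : ∀ s t : ℝ, s ∈ Icc 0 T → t ∈ Icc 0 T → s ≤ t →
      CondLE μ (ℱ s) (fun ω => ENNReal.ofReal (X t ω)) (fun ω => ENNReal.ofReal (X s ω))) :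
    SuperMG μ T ℱ X := by
  have hint : ∀ t ∈ Icc (0 : ℝ) T, Integrable (X t) μ := by
    intro t ht
    refine ⟨(hX.measurable' ht).aestronglyMeasurable, ?_⟩
    rw [hasFiniteIntegral_iff_ofReal (hX.nonneg ht)]
    exact ((h 0 t ⟨le_rfl, ht.1.trans ht.2⟩ ht ht.1).lintegral_le).trans_lt h0.lt_top
  refine ⟨hX, hint, fun s t hs ht hst => ?_⟩
  exact (h s t hs ht hst).condExp_le (ℱ.le s) (hint t ht) (hX.measurable' ht) (hX.nonneg ht)
    (hX.measurable hs) (hX.nonneg hs)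

/-- A nonnegative supermartingale stays at zero once it vanishes. -/
lemma SuperMG.eq_zero [IsFiniteMeasure μ] (h : SuperMG μ T ℱ X) {s t : ℝ} (hs : s ∈ Icc 0 T)
    (ht : t ∈ Icc 0 T) (hst : s ≤ t) : ∀ᵐ ω ∂μ, X s ω = 0 → X t ω = 0 := by
  have hA : MeasurableSet[ℱ s] {ω | X s ω = 0} :=
    h.1.measurable hs (measurableSet_singleton 0)
  have h1 := (h.condLE hs ht hst).setLIntegral_le (ℱ.le s) hA
  have h2 : ∫⁻ ω in {ω | X s ω = 0}, ENNReal.ofReal (X s ω) ∂μ = 0 := by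
    rw [setLIntegral_congr_fun (g := fun _ => 0) (ℱ.le s _ hA)
      (fun ω (hω : X s ω = 0) => by simp [hω]), lintegral_zero]
  rw [h2, nonpos_iff_eq_zero] at h1
  rw [lintegral_eq_zero_iff (h.1.measurable' ht).ennreal_ofReal,
    Filter.EventuallyEq, ae_restrict_iff' (ℱ.le s _ hA)] at h1
  filter_upwards [h1, h.1.nonneg ht] with ω h2 h3 h4
  exact le_antisymm (ENNReal.ofReal_eq_zero.1 (h2 h4)) h3

lemma SuperMG.pos [IsFiniteMeasure μ] (h : SuperMG μ T ℱ X) (hX : ∀ᵐ ω ∂μ, 0 < X T ω)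
    {s : ℝ} (hs : s ∈ Icc 0 T) : ∀ᵐ ω ∂μ, 0 < X s ω := by
  filter_upwards [h.eq_zero hs ⟨hs.1.trans hs.2, le_rfl⟩ hs.2, h.1.nonneg hs, hX]
    with ω h1 h2 h3
  exact lt_of_le_of_ne h2 fun h => h3.ne' (h1 h.symm)

end Supermartingale

section Cadlag

variable {T : ℝ} {f g : ℝ → ℝ}

lemma CadlagOn.const (c : ℝ) : CadlagOn T (fun _ => c) :=
  ⟨fun _ _ => tendsto_const_nhds, fun _ _ => ⟨c, tendsto_const_nhds⟩⟩

lemma CadlagOn.mul (hf : CadlagOn T f) (hg : CadlagOn T g) : CadlagOn T (fun t => f t * g t) := by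
  refine ⟨fun t ht => (hf.1 t ht).mul (hg.1 t ht), fun t ht => ?_⟩
  obtain ⟨L, hL⟩ := hf.2 t ht
  obtain ⟨M, hM⟩ := hg.2 t ht
  exact ⟨L * M, hL.mul hM⟩

lemma CadlagOn.add (hf : CadlagOn T f) (hg : CadlagOn T g) : CadlagOn T (fun t => f t + g t) := by
  refine ⟨fun t ht => (hf.1 t ht).add (hg.1 t ht), fun t ht => ?_⟩
  obtain ⟨L, hL⟩ := hf.2 t ht
  obtain ⟨M, hM⟩ := hg.2 t ht
  exact ⟨L + M, hL.add hM⟩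

lemma CadlagOn.ite (s : ℝ) (hf : CadlagOn T f) (hg : CadlagOn T g) :
    CadlagOn T (fun t => if t < s then f t else g t) := by
  constructor
  · intro t ht
    rcases lt_or_ge t s with h | h
    · simp only [h, if_true]
      refine (hf.1 t ht).congr' ?_
      filter_upwards [nhdsWithin_le_nhds (Iio_mem_nhds h)] with u hu
      simp [mem_Iio.1 hu]
    · simp only [h.not_gt, if_false]
      refine (hg.1 t ht).congr' ?_
      filter_upwards [self_mem_nhdsWithin] with u hu
      simp [(h.trans (mem_Ioi.1 hu).le).not_gt]
  · intro t ht
    rcases le_or_gt t s with h | h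
    · obtain ⟨L, hL⟩ := hf.2 t ht
      refine ⟨L, hL.congr' ?_⟩
      filter_upwards [self_mem_nhdsWithin] with u hu
      simp [(mem_Iio.1 hu).trans_le h]
    · obtain ⟨L, hL⟩ := hg.2 t ht
      refine ⟨L, hL.congr' ?_⟩
      filter_upwards [nhdsWithin_le_nhds (Ioi_mem_nhds h)] with u hu
      simp [(mem_Ioi.1 hu).le.not_gt]

end Cadlag

section Polar

variable {m0 : MeasurableSpace Ω} {μ : Measure Ω} {T : ℝ} {ℱ : Filtration ℝ m0}
  {X Y Y1 Y2 Y3 : ℝ → Ω → ℝ} {G : Set (ℝ → Ω → ℝ)}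

/-- The process which follows `Y1` until time `s` and then evolves proportionally to the mixture
of `Y2` and `Y3` with weights `h` and `1 - h`. -/
noncomputable def fork (s : ℝ) (h : Ω → ℝ) (Y1 Y2 Y3 : ℝ → Ω → ℝ) : ℝ → Ω → ℝ :=
  fun t ω => if t < s then Y1 t ω
    else Y1 s ω * (h ω * (Y2 t ω / Y2 s ω) + (1 - h ω) * (Y3 t ω / Y3 s ω))

lemma fork_of_lt {s t : ℝ} (h : Ω → ℝ) (hst : t < s) : fork s h Y1 Y2 Y3 t = Y1 t := by
  ext ω; simp [fork, hst]

lemma fork_of_le {s t : ℝ} (h : Ω → ℝ) (hst : s ≤ t) (ω : Ω) : fork s h Y1 Y2 Y3 t ω =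
    Y1 s ω * (h ω * (Y2 t ω / Y2 s ω) + (1 - h ω) * (Y3 t ω / Y3 s ω)) := by
  simp [fork, hst.not_gt]

lemma PosProc.const {c : ℝ} (hc : 0 ≤ c) : PosProc μ T ℱ (fun _ _ => c) :=
  ⟨fun _ _ => stronglyMeasurable_const, ae_of_all _ fun _ _ _ => hc,
    ae_of_all _ fun _ => CadlagOn.const c⟩

lemma PosProc.mul (hX : PosProc μ T ℱ X) (hY : PosProc μ T ℱ Y) :
    PosProc μ T ℱ (fun t ω => X t ω * Y t ω) := by
  refine ⟨fun t ht => (hX.1 t ht).mul (hY.1 t ht), ?_, ?_⟩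
  · filter_upwards [hX.2.1, hY.2.1] with ω h1 h2 t ht using mul_nonneg (h1 t ht) (h2 t ht)
  · filter_upwards [hX.2.2, hY.2.2] with ω h1 h2 using h1.mul h2

lemma PosProc.fork (h1 : PosProc μ T ℱ Y1) (h2 : PosProc μ T ℱ Y2) (h3 : PosProc μ T ℱ Y3)
    {s : ℝ} (hs : s ∈ Icc 0 T) {h : Ω → ℝ} (hh : StronglyMeasurable[ℱ s] h)
    (hh0 : ∀ ω, 0 ≤ h ω) (hh1 : ∀ ω, h ω ≤ 1) : PosProc μ T ℱ (fork s h Y1 Y2 Y3) := by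
  refine ⟨fun t ht => ?_, ?_, ?_⟩
  · rcases lt_or_ge t s with hst | hst
    · rw [fork_of_lt h hst]; exact h1.1 t ht
    · have e : _root_.fork s h Y1 Y2 Y3 t = fun ω =>
          Y1 s ω * (h ω * (Y2 t ω / Y2 s ω) + (1 - h ω) * (Y3 t ω / Y3 s ω)) :=
        funext (fork_of_le h hst)
      rw [e]
      have hm := ℱ.mono hst
      refine Measurable.stronglyMeasurable ?_
      have a1 := (h1.measurable hs).mono hm le_rfl
      have a2 := (h2.measurable hs).mono hm le_rfl
      have a3 := (h3.measurable hs).mono hm le_rfl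
      have ah := hh.measurable.mono hm le_rfl
      exact a1.mul ((ah.mul ((h2.measurable ht).div a2)).add
        ((measurable_const.sub ah).mul ((h3.measurable ht).div a3)))
  · filter_upwards [h1.2.1, h2.2.1, h3.2.1] with ω g1 g2 g3 t ht
    rcases lt_or_ge t s with hst | hst
    · rw [fork_of_lt h hst]; exact g1 t ht
    · rw [fork_of_le h hst]
      exact mul_nonneg (g1 s hs) (add_nonneg (mul_nonneg (hh0 ω) (div_nonneg (g2 t ht) (g2 s hs)))
        (mul_nonneg (sub_nonneg.2 (hh1 ω)) (div_nonneg (g3 t ht) (g3 s hs))))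
  · filter_upwards [h1.2.2, h2.2.2, h3.2.2] with ω g1 g2 g3
    refine g1.ite s ?_
    simp only [div_eq_mul_inv]
    exact (CadlagOn.const _).mul (((CadlagOn.const _).mul (g2.mul (CadlagOn.const _))).add
      ((CadlagOn.const _).mul (g3.mul (CadlagOn.const _))))

lemma procPolar_anti {G' : Set (ℝ → Ω → ℝ)} (h : G ⊆ G') :
    procPolar μ T ℱ G' ⊆ procPolar μ T ℱ G :=
  fun _ hY => ⟨hY.1, fun X hX => hY.2 X (h hX)⟩

lemma subset_procPolar_procPolar (hG : ∀ X ∈ G, PosProc μ T ℱ X) :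
    G ⊆ procPolar μ T ℱ (procPolar μ T ℱ G) := by
  intro X hX
  refine ⟨hG X hX, fun Z hZ => ?_⟩
  have := hZ.2 X hX
  simpa only [mul_comm] using this

lemma lintegral_ofReal_ne_top_of_le_one [IsProbabilityMeasure μ] {f : Ω → ℝ}
    (hf : ∀ᵐ ω ∂μ, f ω ≤ 1) : ∫⁻ ω, ENNReal.ofReal (f ω) ∂μ ≠ ∞ := by
  refine ne_top_of_le_ne_top ENNReal.one_ne_top ((lintegral_mono_ae (g := fun _ => 1) ?_).trans ?_)
  · filter_upwards [hf] with ω h using ENNReal.ofReal_le_one.2 h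
  · simp

lemma fork_self_le {s x y z w h : ℝ} (hs : 0 ≤ s) (h0 : 0 ≤ h) (h1 : h ≤ 1)
    (e : x = s * (h * (y / y) + (1 - h) * (z / z)) * w) (hw : 0 ≤ w) : x ≤ s * w := by
  rw [e]
  refine mul_le_mul_of_nonneg_right ?_ hw
  have hy := div_self_le_one y
  have hz := div_self_le_one z
  have : h * (y / y) + (1 - h) * (z / z) ≤ 1 := by
    nlinarith
  nlinarith

/-- Fork-convexity of process polars. -/
lemma forkConvex_procPolar [IsProbabilityMeasure μ] (hT : 0 < T)
    (hG : ∀ X ∈ G, PosProc μ T ℱ X) : ForkConvex μ T ℱ (procPolar μ T ℱ G) := by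
  intro s hs h hh hh0 hh1 Y1 hY1 Y2 hY2 Y3 hY3
  change fork s h Y1 Y2 Y3 ∈ _
  have hF := hY1.1.fork hY2.1 hY3.1 hs hh hh0 hh1
  refine ⟨hF, fun X hX => ?_⟩
  have hXp := hG X hX
  have hZ : (0 : ℝ) ∈ Icc 0 T := ⟨le_rfl, hT.le⟩
  have hself : ∀ᵐ ω ∂μ, X s ω * fork s h Y1 Y2 Y3 s ω ≤ X s ω * Y1 s ω := by
    filter_upwards [hXp.2.1, hY1.1.2.1] with ω g0 g1
    rw [fork_of_le h le_rfl, mul_comm (X s ω), mul_comm (X s ω)]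
    exact fork_self_le (g1 s hs) (hh0 ω) (hh1 ω) rfl (g0 s hs)
  have h0 : ∀ᵐ ω ∂μ, X 0 ω * fork s h Y1 Y2 Y3 0 ω ≤ 1 := by
    rcases hs.1.lt_or_eq with h' | h'
    · rw [fork_of_lt h h']; exact (hY1.2 X hX).2
    · subst h'
      filter_upwards [hself, (hY1.2 X hX).2] with ω g1 g2 using g1.trans g2
  refine ⟨superMG_of_condLE (hXp.mul hF) (lintegral_ofReal_ne_top_of_le_one h0) ?_, h0⟩
  have hafter : ∀ u v : ℝ, u ∈ Icc 0 T → v ∈ Icc 0 T → s ≤ u → u ≤ v → CondLE μ (ℱ u)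
      (fun ω => ENNReal.ofReal (X v ω * fork s h Y1 Y2 Y3 v ω))
      (fun ω => ENNReal.ofReal (X u ω * fork s h Y1 Y2 Y3 u ω)) := by
    intro u v hu hv hsu huv
    have hm := ℱ.mono hsu
    have e : ∀ t ∈ Icc 0 T, s ≤ t → (fun ω => ENNReal.ofReal (X t ω * fork s h Y1 Y2 Y3 t ω)) =ᵐ[μ]
        fun ω => ENNReal.ofReal (Y1 s ω * h ω / Y2 s ω) * ENNReal.ofReal (X t ω * Y2 t ω) +
          ENNReal.ofReal (Y1 s ω * (1 - h ω) / Y3 s ω) * ENNReal.ofReal (X t ω * Y3 t ω) := by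
      intro t ht hst
      filter_upwards [hXp.2.1, hY1.1.2.1, hY2.1.2.1, hY3.1.2.1] with ω g0 g1 g2 g3
      have k0 := g0 t ht
      have k1 := g1 s hs
      have k2 := g2 s hs
      have k3 := g3 s hs
      have l2 := g2 t ht
      have l3 := g3 t ht
      have p0 := hh0 ω
      have p1 := sub_nonneg.2 (hh1 ω)
      rw [← ENNReal.ofReal_mul (by positivity), ← ENNReal.ofReal_mul (by positivity),
        ← ENNReal.ofReal_add (by positivity) (by positivity), fork_of_le h hst]
      congr 1; ring
    refine CondLE.ae_trans (e v hv (hsu.trans huv)).le (CondLE.trans_ae ?_ (e u hu hsu).ge)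
    have a1 := (hY1.1.measurable hs).mono hm le_rfl
    have a2 := (hY2.1.measurable hs).mono hm le_rfl
    have a3 := (hY3.1.measurable hs).mono hm le_rfl
    have ah := hh.measurable.mono hm le_rfl
    have c2 : Measurable[ℱ u] fun ω => ENNReal.ofReal (Y1 s ω * h ω / Y2 s ω) :=
      ((a1.mul ah).div a2).ennreal_ofReal
    have c3 : Measurable[ℱ u] fun ω => ENNReal.ofReal (Y1 s ω * (1 - h ω) / Y3 s ω) :=
      ((a1.mul (measurable_const.sub ah)).div a3).ennreal_ofReal
    have q2 := ((hY2.2 X hX).1.condLE hu hv huv).mul c2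
    have q3 := ((hY3.2 X hX).1.condLE hu hv huv).mul c3
    exact q2.add q3 (ℱ.le u)
      ((c2.mono (ℱ.le u) le_rfl).mul ((hY2.2 X hX).1.1.measurable' hu).ennreal_ofReal)
      ((c2.mono (ℱ.le u) le_rfl).mul ((hY2.2 X hX).1.1.measurable' hv).ennreal_ofReal)
  intro u v hu hv huv
  rcases lt_or_ge u s with hus | hus
  · rcases lt_or_ge v s with hvs | hvs
    · rw [fork_of_lt h hus, fork_of_lt h hvs]
      exact (hY1.2 X hX).1.condLE hu hv huv
    · refine (hafter s v hs hv le_rfl hvs).trans (CondLE.ae_trans (b := fun ω =>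
        ENNReal.ofReal (X s ω * Y1 s ω)) ?_ ?_) (ℱ.mono hus.le)
      · filter_upwards [hself] with ω hω using ENNReal.ofReal_le_ofReal hω
      · rw [fork_of_lt h hus]
        exact (hY1.2 X hX).1.condLE hu hs hus.le
  · exact hafter u v hu hv hus huv

/-- Solidity of process polars. -/
lemma procSolid_procPolar [IsProbabilityMeasure μ] (hT : 0 < T)
    (hG : ∀ X ∈ G, PosProc μ T ℱ X) : ProcSolid μ T ℱ (procPolar μ T ℱ G) := by
  intro Y hY B hB
  refine ⟨hY.1.mul hB.1, fun X hX => ?_⟩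
  have hZ : (0 : ℝ) ∈ Icc 0 T := ⟨le_rfl, hT.le⟩
  have hXY := hY.2 X hX
  have h0 : ∀ᵐ ω ∂μ, X 0 ω * (Y 0 ω * B 0 ω) ≤ 1 := by
    filter_upwards [hXY.2, hB.2.2, hXY.1.1.nonneg hZ] with ω g1 g2 g3
    rw [← mul_assoc]
    nlinarith
  refine ⟨superMG_of_condLE ((hG X hX).mul (hY.1.mul hB.1))
    (lintegral_ofReal_ne_top_of_le_one h0) ?_, h0⟩
  intro u v hu hv huv
  have q := (hXY.1.condLE hu hv huv).mul (hB.1.measurable hu).ennreal_ofReal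
  refine CondLE.ae_trans ?_ (q.trans_ae ?_)
  · filter_upwards [hXY.1.1.nonneg hv, hB.2.1, hB.1.nonneg hu] with ω g1 g2 g3
    rw [← ENNReal.ofReal_mul g3]
    refine ENNReal.ofReal_le_ofReal ?_
    nlinarith [g2 u hu v hv huv]
  · filter_upwards [hB.1.nonneg hu] with ω g3
    rw [← ENNReal.ofReal_mul g3]
    refine ENNReal.ofReal_le_ofReal (le_of_eq (by ring))

end Polar

section CondLELimits

variable {m m0 : MeasurableSpace Ω} {μ : Measure Ω} {a b a' b' : Ω → ℝ≥0∞}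

lemma CondLE.min (h : CondLE μ m b a) (h' : CondLE μ m b' a') (hm : m ≤ m0)
    (ha : Measurable[m] a) (ha' : Measurable[m] a') :
    CondLE μ m (fun ω => min (b ω) (b' ω)) (fun ω => min (a ω) (a' ω)) := by
  intro φ hφ
  have hA : MeasurableSet[m] {ω | a ω ≤ a' ω} := measurableSet_le ha ha'
  set A := {ω | a ω ≤ a' ω} with hAdef
  have h1 := h (A.indicator φ) (hφ.indicator hA)
  have h2 := h' (Aᶜ.indicator φ) (hφ.indicator hA.compl)
  have e : ∀ (B : Set Ω) (f : Ω → ℝ≥0∞), (∫⁻ ω, B.indicator φ ω * f ω ∂μ) =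
      ∫⁻ ω, B.indicator (fun ω => φ ω * f ω) ω ∂μ := by
    intro B f
    congr 1 with ω
    by_cases hω : ω ∈ B <;> simp [hω]
  rw [e, e, lintegral_indicator (hm _ hA), lintegral_indicator (hm _ hA)] at h1
  rw [e, e, lintegral_indicator (hm _ hA.compl), lintegral_indicator (hm _ hA.compl)] at h2
  rw [← lintegral_add_compl (fun ω => φ ω * Min.min (b ω) (b' ω)) (hm _ hA),
    ← lintegral_add_compl (fun ω => φ ω * Min.min (a ω) (a' ω)) (hm _ hA)]
  refine add_le_add ?_ ?_
  · refine (lintegral_mono fun ω => mul_le_mul_right (min_le_left _ _) _).trans (h1.trans ?_)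
    refine (setLIntegral_congr_fun (hm _ hA) fun ω hω => ?_).le
    rw [min_eq_left (show a ω ≤ a' ω from hω)]
  · refine (lintegral_mono fun ω => mul_le_mul_right (min_le_right _ _) _).trans (h2.trans ?_)
    refine (setLIntegral_congr_fun (hm _ hA.compl) fun ω hω => ?_).le
    rw [min_eq_right (not_le.1 (show ¬ a ω ≤ a' ω from hω)).le]

lemma condLE_of_tendsto_left {b : ℕ → Ω → ℝ≥0∞} {b' : Ω → ℝ≥0∞} (hm : m ≤ m0)
    (ha : Measurable[m0] a) (hb : ∀ n, Measurable[m0] (b n)) (hb' : Measurable[m0] b')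
    (hlim : ∀ᵐ ω ∂μ, Tendsto (fun n => b n ω) atTop (𝓝 (b' ω)))
    (h : ∀ᶠ n in atTop, CondLE μ m (b n) a) : CondLE μ m b' a := by
  refine condLE_of_forall_set hm ha hb' fun A hA => ?_
  calc ∫⁻ ω in A, b' ω ∂μ = ∫⁻ ω in A, liminf (fun n => b n ω) atTop ∂μ := by
        refine lintegral_congr_ae (ae_restrict_of_ae ?_)
        filter_upwards [hlim] with ω hω using hω.liminf_eq.symm
    _ ≤ liminf (fun n => ∫⁻ ω in A, b n ω ∂μ) atTop := lintegral_liminf_le hb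
    _ ≤ liminf (fun _ : ℕ => ∫⁻ ω in A, a ω ∂μ) atTop :=
        liminf_le_liminf (h.mono fun n hn => hn.setLIntegral_le hm hA)
    _ = ∫⁻ ω in A, a ω ∂μ := by simp

lemma condLE_of_tendsto_right [IsFiniteMeasure μ] {M : ℕ → MeasurableSpace Ω}
    {a : ℕ → Ω → ℝ≥0∞} {a' : Ω → ℝ≥0∞} (hm : ∀ n, m ≤ M n) (hM : ∀ n, M n ≤ m0)
    (ha : ∀ n, Measurable[M n] (a n)) (ha' : Measurable[m0] a') (hb : Measurable[m0] b)
    (hlim : ∀ᵐ ω ∂μ, Tendsto (fun n => a n ω) atTop (𝓝 (a' ω)))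
    (h : ∀ᶠ n in atTop, CondLE μ (M n) b (a n)) : CondLE μ m b a' := by
  have hm0 : m ≤ m0 := (hm 0).trans (hM 0)
  have key : ∀ K : ℕ, CondLE μ m (fun ω => Min.min (b ω) K) a' := by
    intro K
    refine condLE_of_forall_set hm0 ha' (hb.min measurable_const) fun A hA => ?_
    have hlim2 : Tendsto (fun n => ∫⁻ ω in A, Min.min (a n ω) K ∂μ) atTop
        (𝓝 (∫⁻ ω in A, Min.min (a' ω) K ∂μ)) := by
      refine tendsto_lintegral_of_dominated_convergence (fun _ => K)
        (fun n => ((ha n).mono (hM n) le_rfl).min measurable_const)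
        (fun n => ae_of_all _ fun ω => min_le_right _ _) ?_ ?_
      · simp [ENNReal.mul_eq_top]
      · refine ae_restrict_of_ae ?_
        filter_upwards [hlim] with ω hω using hω.min tendsto_const_nhds
    refine (ge_of_tendsto hlim2 ?_).trans (lintegral_mono fun ω => min_le_left _ _)
    filter_upwards [h] with n hn
    exact (hn.min (fun _ _ => le_rfl) (hM n) (ha n) measurable_const).setLIntegral_le (hM n)
      (hm n _ hA)
  refine condLE_of_tendsto_left (b := fun K ω => Min.min (b ω) K) hm0 ha'
    (fun K => hb.min measurable_const) hb (ae_of_all _ fun ω => ?_) (Eventually.of_forall key)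
  have := (tendsto_const_nhds (x := b ω)).min ENNReal.tendsto_nat_nhds_top
  simpa using this

lemma condLE_of_rightLimit [IsFiniteMeasure μ] {M : ℕ → MeasurableSpace Ω}
    {a b : ℕ → Ω → ℝ≥0∞} {a' b' : Ω → ℝ≥0∞} (hm : ∀ n, m ≤ M n) (hM : ∀ n, M n ≤ m0)
    (ha : ∀ n, Measurable[M n] (a n)) (ha' : Measurable[m0] a')
    (hb : ∀ n, Measurable[m0] (b n)) (hb' : Measurable[m0] b')
    (hlima : ∀ᵐ ω ∂μ, Tendsto (fun n => a n ω) atTop (𝓝 (a' ω)))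
    (hlimb : ∀ᵐ ω ∂μ, Tendsto (fun n => b n ω) atTop (𝓝 (b' ω)))
    (h : ∀ᶠ n in atTop, ∀ᶠ k in atTop, CondLE μ (M n) (b k) (a n)) : CondLE μ m b' a' :=
  condLE_of_tendsto_right hm hM ha ha' hb' hlima <| h.mono fun n hn =>
    condLE_of_tendsto_left (hM n) ((ha n).mono (hM n) le_rfl) hb hb' hlimb hn

lemma condLE_liminf [IsFiniteMeasure μ] {a b : ℕ → Ω → ℝ≥0∞} (hm : m ≤ m0)
    (ha : ∀ n, Measurable[m] (a n)) (hb : ∀ n, Measurable[m0] (b n))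
    (h : ∀ n, CondLE μ m (b n) (a n)) :
    CondLE μ m (fun ω => liminf (fun n => b n ω) atTop) (fun ω => liminf (fun n => a n ω) atTop) := by
  have hfin : ∀ N n : ℕ, CondLE μ m (fun ω => ⨅ k ∈ Finset.range (n + 1), b (k + N) ω)
      (fun ω => ⨅ k ∈ Finset.range (n + 1), a (k + N) ω) := by
    intro N n
    induction n with
    | zero => simpa using h N
    | succ n ih =>
      have := ih.min (h (n + 1 + N)) hm (Measurable.biInf _ (Finset.countable_toSet _)
        fun k _ => ha (k + N)) (ha _)
      simp only [Finset.range_add_one (n := n + 1), Finset.iInf_insert]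
      simpa only [inf_comm] using this
  have ham := fun n => (ha n).mono hm le_rfl
  have hinf : ∀ N : ℕ, CondLE μ m (fun ω => ⨅ k, b (k + N) ω) (fun ω => ⨅ k, a (k + N) ω) := by
    intro N
    refine condLE_of_tendsto_right (M := fun _ => m)
      (a := fun n ω => ⨅ k ∈ Finset.range (n + 1), a (k + N) ω) (fun _ => le_rfl) (fun _ => hm)
      (fun n => Measurable.biInf _ (Finset.countable_toSet _) fun k _ => ha (k + N))
      (Measurable.iInf fun k => ham _) (Measurable.iInf fun k => hb _) (ae_of_all _ fun ω => ?_)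
      (Eventually.of_forall fun n => CondLE.ae_trans (ae_of_all _ fun ω => ?_) (hfin N n))
    · have hanti : Antitone fun n : ℕ => ⨅ k ∈ Finset.range (n + 1), a (k + N) ω := by
        intro i j hij
        exact biInf_mono fun k hk => by simp only [Finset.mem_range] at *; omega
      have := tendsto_atTop_iInf hanti
      convert this using 2
      refine le_antisymm (le_iInf fun n => le_iInf₂ fun k _ => iInf_le _ k)
        (le_iInf fun k => (iInf_le _ k).trans (iInf₂_le k (by simp)))
    · exact le_iInf₂ fun k _ => iInf_le _ k
  have hlim : ∀ (f : ℕ → Ω → ℝ≥0∞) ω, Tendsto (fun N => ⨅ k, f (k + N) ω) atTop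
      (𝓝 (liminf (fun n => f n ω) atTop)) := by
    intro f ω
    rw [liminf_eq_iSup_iInf_of_nat']
    refine tendsto_atTop_iSup fun i j hij => le_iInf fun k => ?_
    have e : k + (j - i) + i = k + j := by omega
    exact (iInf_le _ (k + (j - i))).trans (by rw [e])
  have hfinal : ∀ N : ℕ, CondLE μ m (fun ω => ⨅ k, b (k + N) ω)
      (fun ω => liminf (fun n => a n ω) atTop) := fun N =>
    (hinf N).trans_ae (ae_of_all _ fun ω => by
      beta_reduce
      rw [liminf_eq_iSup_iInf_of_nat']; exact le_iSup (fun n => ⨅ i, a (i + n) ω) N)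
  exact condLE_of_tendsto_left hm (Measurable.liminf ham)
    (fun N => Measurable.iInf fun k => hb _) (Measurable.liminf hb)
    (ae_of_all _ (hlim b)) (Eventually.of_forall hfinal)

end CondLELimits

section FatouClosedPolar

variable {m0 : MeasurableSpace Ω} {μ : Measure Ω} {T : ℝ} {ℱ : Filtration ℝ m0}
  {X Y : ℝ → Ω → ℝ} {G : Set (ℝ → Ω → ℝ)}

lemma FatouConv.exists_seq {Yn : ℕ → ℝ → Ω → ℝ} (hX : PosProc μ T ℱ X) (hY : PosProc μ T ℱ Y)
    (h : FatouConv μ T Yn Y) {t : ℝ} (ht : t ∈ Icc 0 T) :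
    ∃ q : ℕ → ℝ, (∀ n, q n ∈ Icc t T) ∧ Tendsto q atTop (𝓝 t) ∧ ∀ᵐ ω ∂μ,
      Tendsto (fun k => liminf (fun n => ENNReal.ofReal (X (q k) ω * Yn n (q k) ω)) atTop) atTop
        (𝓝 (ENNReal.ofReal (X t ω * Y t ω))) := by
  obtain ⟨T', -, hsub, hdense, hconv⟩ := h
  rcases ht.2.lt_or_eq with htT | rfl
  · have hne : (𝓝[Ioi t ∩ T'] t).NeBot := by
      rw [← mem_closure_iff_nhdsWithin_neBot, Metric.mem_closure_iff]
      intro ε hε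
      have hlt : t < min T (t + ε) := lt_min htT (by linarith)
      obtain ⟨c, hc1, hc2⟩ := exists_between hlt
      have hcT : c ∈ closure T' := hdense ⟨ht.1.trans hc1.le, (hc2.trans_le (min_le_left _ _)).le⟩
      obtain ⟨r, hr1, hr2⟩ := mem_closure_iff_nhds.1 hcT _ (Ioo_mem_nhds hc1 hc2)
      refine ⟨r, ⟨hr1.1, hr2⟩, ?_⟩
      have := hr1.2.trans_le (min_le_right _ _)
      rw [dist_comm, Real.dist_eq, abs_of_pos (sub_pos.2 hr1.1)]
      linarith
    obtain ⟨q, hq⟩ := exists_seq_tendsto (𝓝[Ioi t ∩ T'] t)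
    have hqm : ∀ᶠ n in atTop, q n ∈ Ioi t ∩ T' := hq.eventually self_mem_nhdsWithin
    obtain ⟨N, hN⟩ := eventually_atTop.1 hqm
    have hq' : Tendsto (fun n => q (n + N)) atTop (𝓝[Ioi t ∩ T'] t) :=
      hq.comp (tendsto_add_atTop_nat N)
    have hmem : ∀ n, q (n + N) ∈ Ioi t ∩ T' := fun n => hN _ (Nat.le_add_left _ _)
    refine ⟨fun n => q (n + N), fun n => ⟨(hmem n).1.le, (hsub (hmem n).2).2⟩,
      hq'.mono_right nhdsWithin_le_nhds, ?_⟩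
    filter_upwards [hconv, hX.2.1, hX.2.2] with ω h1 h2 h3
    obtain ⟨hl, hu⟩ := h1.1 t ⟨ht.1, htT⟩
    have hlim : Tendsto (fun s => liminf (fun n => ENNReal.ofReal (Yn n s ω)) atTop)
        (𝓝[Ioi t ∩ T'] t) (𝓝 (ENNReal.ofReal (Y t ω))) := by
      refine tendsto_of_le_liminf_of_limsup_le hl.le (le_trans ?_ hu.ge)
      exact limsup_le_limsup (Eventually.of_forall fun s => liminf_le_limsup)
    have hXlim : Tendsto (fun s => ENNReal.ofReal (X s ω)) (𝓝[Ioi t ∩ T'] t)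
        (𝓝 (ENNReal.ofReal (X t ω))) :=
      ENNReal.tendsto_ofReal ((h3.1 t ⟨ht.1, htT⟩).mono_left
        (nhdsWithin_mono _ inter_subset_left))
    have := (ENNReal.Tendsto.mul hXlim (Or.inr ENNReal.ofReal_ne_top) hlim
      (Or.inr ENNReal.ofReal_ne_top)).comp hq'
    rw [ENNReal.ofReal_mul (h2 t ht)]
    refine this.congr fun k => ?_
    have hk : 0 ≤ X (q (k + N)) ω := h2 _ (hsub (hmem k).2)
    simp only [ENNReal.ofReal_mul hk, Function.comp]
    rw [ENNReal.liminf_const_mul_of_ne_top ENNReal.ofReal_ne_top]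
  · refine ⟨fun _ => t, fun _ => ⟨le_rfl, le_rfl⟩, tendsto_const_nhds, ?_⟩
    filter_upwards [hconv] with ω h1
    have := (ENNReal.tendsto_ofReal (h1.2.const_mul (X t ω))).liminf_eq
    rw [this]
    exact tendsto_const_nhds

/-- Process polars are closed under Fatou convergence. -/
lemma fatouClosed_procPolar [IsProbabilityMeasure μ] (hT : 0 < T)
    (hG : ∀ X ∈ G, PosProc μ T ℱ X) : FatouClosed μ T ℱ (procPolar μ T ℱ G) := by
  intro Yn Y hYn hY hconv
  refine ⟨hY, fun X hX => ?_⟩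
  have hXp := hG X hX
  have hZ : (0 : ℝ) ∈ Icc 0 T := ⟨le_rfl, hT.le⟩
  set U : ℝ → Ω → ℝ≥0∞ :=
    fun q ω => liminf (fun n => ENNReal.ofReal (X q ω * Yn n q ω)) atTop with hU
  have hUm : ∀ q ∈ Icc 0 T, Measurable[ℱ q] (U q) := fun q hq =>
    Measurable.liminf fun n => ((hXp.mul (hYn n).1).measurable hq).ennreal_ofReal
  have hUm' : ∀ q ∈ Icc 0 T, Measurable (U q) := fun q hq => (hUm q hq).mono (ℱ.le q) le_rfl
  have hVm : ∀ q ∈ Icc 0 T, Measurable[ℱ q] fun ω => ENNReal.ofReal (X q ω * Y q ω) :=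
    fun q hq => ((hXp.mul hY).measurable hq).ennreal_ofReal
  have hVm' : ∀ q ∈ Icc 0 T, Measurable fun ω => ENNReal.ofReal (X q ω * Y q ω) :=
    fun q hq => (hVm q hq).mono (ℱ.le q) le_rfl
  have hUc : ∀ u ∈ Icc 0 T, ∀ v ∈ Icc 0 T, u ≤ v → CondLE μ (ℱ u) (U v) (U u) :=
    fun u hu v hv huv => condLE_liminf (ℱ.le u)
      (fun n => ((hXp.mul (hYn n).1).measurable hu).ennreal_ofReal)
      (fun n => ((hXp.mul (hYn n).1).measurable' hv).ennreal_ofReal)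
      (fun n => ((hYn n).2 X hX).1.condLE hu hv huv)
  have hU1 : ∀ v ∈ Icc 0 T, CondLE μ (ℱ 0) (U v) (fun _ => 1) := by
    intro v hv
    refine (hUc 0 hZ v hv hv.1).trans_ae ?_
    have : ∀ᵐ ω ∂μ, ∀ n, X 0 ω * Yn n 0 ω ≤ 1 := ae_all_iff.2 fun n => ((hYn n).2 X hX).2
    filter_upwards [this] with ω hω
    refine (liminf_le_liminf (Eventually.of_forall fun n => ?_)).trans
      (liminf_const (1 : ℝ≥0∞)).le
    exact ENNReal.ofReal_le_one.2 (hω n)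
  have h0 : ∀ᵐ ω ∂μ, X 0 ω * Y 0 ω ≤ 1 := by
    obtain ⟨q, hq, -, hlim⟩ := hconv.exists_seq hXp hY hZ
    have := condLE_of_tendsto_left (ℱ.le 0) measurable_const (fun n => hUm' (q n) (hq n))
      (hVm' 0 hZ) hlim (Eventually.of_forall fun n => hU1 (q n) (hq n))
    filter_upwards [this.ae_le (ℱ.le 0) measurable_const (hVm 0 hZ)] with ω hω
    exact ENNReal.ofReal_le_one.1 hω
  refine ⟨superMG_of_condLE (hXp.mul hY) (lintegral_ofReal_ne_top_of_le_one h0) ?_, h0⟩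
  intro u v hu hv huv
  rcases huv.lt_or_eq with huv | rfl
  · obtain ⟨q, hq, hqlim, hq'⟩ := hconv.exists_seq hXp hY hu
    obtain ⟨r, hr, -, hr'⟩ := hconv.exists_seq hXp hY hv
    have hqI : ∀ n, q n ∈ Icc 0 T := fun n => ⟨hu.1.trans (hq n).1, (hq n).2⟩
    have hrI : ∀ n, r n ∈ Icc 0 T := fun n => ⟨hv.1.trans (hr n).1, (hr n).2⟩
    refine condLE_of_rightLimit (M := fun n => ℱ (q n)) (fun n => ℱ.mono (hq n).1)
      (fun n => ℱ.le _) (fun n => hUm _ (hqI n)) (hVm' u hu) (fun n => hUm' _ (hrI n))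
      (hVm' v hv) hq' hr' ?_
    filter_upwards [hqlim.eventually (Iio_mem_nhds huv)] with n hn
    exact Eventually.of_forall fun k =>
      hUc _ (hqI n) _ (hrI k) ((mem_Iio.1 hn).le.trans (hr k).1)
  · exact fun _ _ => le_rfl

end FatouClosedPolar

section Paths

/-- The dyadic rationals. -/
def dyadics : Set ℝ := {x | ∃ n j : ℕ, x = j / 2 ^ n}

lemma exists_dyadic_btwn {x y : ℝ} (hx : 0 ≤ x) (hxy : x < y) : ∃ q ∈ dyadics, x < q ∧ q < y := by
  obtain ⟨n, hn⟩ := exists_pow_lt_of_lt_one (sub_pos.2 hxy) (by norm_num : (1 / 2 : ℝ) < 1)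
  have h2 : (0 : ℝ) < 2 ^ n := by positivity
  rw [one_div, inv_pow] at hn
  refine ⟨(⌊x * 2 ^ n⌋₊ + 1 : ℕ) / 2 ^ n, ⟨n, _, rfl⟩, ?_, ?_⟩
  · rw [lt_div_iff₀ h2]
    exact_mod_cast Nat.lt_floor_add_one (x * 2 ^ n)
  · have := Nat.floor_le (show 0 ≤ x * 2 ^ n by positivity)
    rw [div_lt_iff₀ h2]
    have e : (y - x) * 2 ^ n > 1 := by
      have := mul_lt_mul_of_pos_right hn h2
      rwa [inv_mul_cancel₀ h2.ne'] at this
    push_cast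
    linarith

lemma exists_alternating_seq {r : ℝ → ℝ → Prop} {S : Set ℝ} {f : ℝ → ℝ} {a b : ℝ}
    (hS : S.Nonempty) (ha : ∀ x ∈ S, ∃ y ∈ S, r x y ∧ f y < a)
    (hb : ∀ x ∈ S, ∃ y ∈ S, r x y ∧ b < f y) :
    ∃ p : ℕ → ℝ, ∀ i, p i ∈ S ∧ r (p i) (p (i + 1)) ∧ f (p (2 * i)) < a ∧
      b < f (p (2 * i + 1)) := by
  obtain ⟨x, hx⟩ := hS
  have ha' : ∀ x : S, ∃ y : S, r x y ∧ f y < a := fun x => by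
    obtain ⟨y, hy, h⟩ := ha x x.2; exact ⟨⟨y, hy⟩, h⟩
  have hb' : ∀ x : S, ∃ y : S, r x y ∧ b < f y := fun x => by
    obtain ⟨y, hy, h⟩ := hb x x.2; exact ⟨⟨y, hy⟩, h⟩
  choose A hA using ha'
  choose B hB using hb'
  let p : ℕ → S := fun n => Nat.rec (A ⟨x, hx⟩) (fun n y => if Even n then B y else A y) n
  have hp0 : p 0 = A ⟨x, hx⟩ := rfl
  have hps : ∀ n, p (n + 1) = if Even n then B (p n) else A (p n) := fun n => rfl
  let p' : ℕ → ℝ := fun n => (p n).1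
  refine ⟨p', fun i => ⟨(p i).2, ?_, ?_, ?_⟩⟩
  · simp only [p', hps]
    split_ifs
    · exact (hB _).1
    · exact (hA _).1
  · cases i with
    | zero => simpa [p', hp0] using (hA ⟨x, hx⟩).2
    | succ i =>
      have e : p (2 * (i + 1)) = A (p (2 * i + 1)) := by
        rw [show 2 * (i + 1) = 2 * i + 1 + 1 by ring, hps, if_neg (by simp)]
      simp only [p', e]
      exact (hA _).2
  · have e : p (2 * i + 1) = B (p (2 * i)) := by rw [hps, if_pos (by simp)]
    simp only [p', e]
    exact (hB _).2

/-- The number of upcrossings of `f` from below `a` to above `b` along points of `S` is bounded. -/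
def AlternatingBound (S : Set ℝ) (f : ℝ → ℝ) (a b : ℝ) : Prop :=
  ∃ k : ℕ, ∀ p : ℕ → ℝ, (∀ i < 2 * k, p i ∈ S) → (∀ i, i + 1 < 2 * k → p i < p (i + 1)) →
    ¬ ∀ i < k, f (p (2 * i)) < a ∧ b < f (p (2 * i + 1))

lemma AlternatingBound.exists_tendsto_right {S : Set ℝ} {f : ℝ → ℝ} {u : ℝ}
    (H : ∀ a b : ℚ, a < b → AlternatingBound S f a b)
    (h : IsBoundedUnder (· ≤ ·) (𝓝[Ioi u ∩ S] u) f)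
    (h' : IsBoundedUnder (· ≥ ·) (𝓝[Ioi u ∩ S] u) f) :
    ∃ L, Tendsto f (𝓝[Ioi u ∩ S] u) (𝓝 L) := by
  refine tendsto_of_no_upcrossings (s := range ((↑) : ℚ → ℝ)) Rat.denseRange_cast ?_ h h'
  rintro _ ⟨a, rfl⟩ _ ⟨b, rfl⟩ hab ⟨hfa, hfb⟩
  obtain ⟨k, hk⟩ := H a b (by exact_mod_cast hab)
  have step : ∀ P : ℝ → Prop, (∃ᶠ x in 𝓝[Ioi u ∩ S] u, P x) →
      ∀ x ∈ Ioi u ∩ S, ∃ y ∈ Ioi u ∩ S, y < x ∧ P y := by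
    intro P hP x hx
    obtain ⟨y, ⟨hy1, hy2⟩, hy3⟩ := ((hP.and_eventually self_mem_nhdsWithin).and_eventually
      (nhdsWithin_le_nhds (Iio_mem_nhds hx.1))).exists
    exact ⟨y, hy2, hy3, hy1⟩
  obtain ⟨x, -, hx⟩ := (hfa.and_eventually self_mem_nhdsWithin).exists
  obtain ⟨p, hp⟩ := exists_alternating_seq (r := fun x y => y < x) ⟨x, hx⟩ (step _ hfa) (step _ hfb)
  refine hk (fun i => p (2 * k - i)) (fun i _ => (hp _).1.2) (fun i hi => ?_) fun i hi => ⟨?_, ?_⟩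
  · have := (hp (2 * k - (i + 1))).2.1
    rwa [show 2 * k - (i + 1) + 1 = 2 * k - i by omega] at this
  · have := (hp (k - i)).2.2.1
    rwa [show 2 * (k - i) = 2 * k - 2 * i by omega] at this
  · have := (hp (k - i - 1)).2.2.2
    rwa [show 2 * (k - i - 1) + 1 = 2 * k - (2 * i + 1) by omega] at this

lemma AlternatingBound.exists_tendsto_left {S : Set ℝ} {f : ℝ → ℝ} {u : ℝ}
    (H : ∀ a b : ℚ, a < b → AlternatingBound S f a b)
    (h : IsBoundedUnder (· ≤ ·) (𝓝[Iio u ∩ S] u) f)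
    (h' : IsBoundedUnder (· ≥ ·) (𝓝[Iio u ∩ S] u) f) :
    ∃ L, Tendsto f (𝓝[Iio u ∩ S] u) (𝓝 L) := by
  refine tendsto_of_no_upcrossings (s := range ((↑) : ℚ → ℝ)) Rat.denseRange_cast ?_ h h'
  rintro _ ⟨a, rfl⟩ _ ⟨b, rfl⟩ hab ⟨hfa, hfb⟩
  obtain ⟨k, hk⟩ := H a b (by exact_mod_cast hab)
  have step : ∀ P : ℝ → Prop, (∃ᶠ x in 𝓝[Iio u ∩ S] u, P x) →
      ∀ x ∈ Iio u ∩ S, ∃ y ∈ Iio u ∩ S, x < y ∧ P y := by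
    intro P hP x hx
    obtain ⟨y, ⟨hy1, hy2⟩, hy3⟩ := ((hP.and_eventually self_mem_nhdsWithin).and_eventually
      (nhdsWithin_le_nhds (Ioi_mem_nhds hx.1))).exists
    exact ⟨y, hy2, hy3, hy1⟩
  obtain ⟨x, -, hx⟩ := (hfa.and_eventually self_mem_nhdsWithin).exists
  obtain ⟨p, hp⟩ := exists_alternating_seq (r := fun x y => x < y) ⟨x, hx⟩ (step _ hfa) (step _ hfb)
  exact hk p (fun i _ => (hp _).1.2) (fun i _ => (hp i).2.1) fun i _ => (hp i).2.2

lemma cadlagOn_of_tendsto {T : ℝ} {S : Set ℝ} {w z : ℝ → ℝ}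
    (hS : ∀ x y, 0 ≤ x → x < y → y ≤ T → ∃ q ∈ S, x < q ∧ q < y)
    (hr : ∀ u ∈ Ico 0 T, Tendsto w (𝓝[Ioi u ∩ S] u) (𝓝 (z u)))
    (hl : ∀ u ∈ Ioc 0 T, ∃ L, Tendsto w (𝓝[Iio u ∩ S] u) (𝓝 L)) : CadlagOn T z := by
  have key : ∀ (x y : ℝ) (F : Set ℝ), IsClosed F → 0 ≤ x → y ≤ T →
      (∀ q ∈ S, x < q → q < y → w q ∈ F) → ∀ v, x < v → v < y → z v ∈ F := by
    intro x y F hF hx hy hw v hxv hvy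
    have hv : v ∈ Ico 0 T := ⟨hx.trans hxv.le, hvy.trans_le hy⟩
    have hne : (𝓝[Ioi v ∩ S] v).NeBot := by
      rw [← mem_closure_iff_nhdsWithin_neBot, Metric.mem_closure_iff]
      intro ε hε
      obtain ⟨q, hq, h1, h2⟩ := hS v (min T (v + ε)) hv.1 (lt_min hv.2 (by linarith))
        (min_le_left _ _)
      refine ⟨q, ⟨h1, hq⟩, ?_⟩
      have := h2.trans_le (min_le_right _ _)
      rw [dist_comm, Real.dist_eq, abs_of_pos (sub_pos.2 h1)]
      linarith
    refine hF.mem_of_tendsto (hr v hv) ?_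
    filter_upwards [self_mem_nhdsWithin, nhdsWithin_le_nhds (Iio_mem_nhds hvy)] with q hq hqy
    exact hw q hq.2 (hxv.trans hq.1) hqy
  constructor
  · intro u hu
    rw [(closed_nhds_basis (z u)).tendsto_right_iff]
    rintro F ⟨hF, hFc⟩
    have h1 := hr u hu hF
    rw [mem_map, mem_nhdsWithin] at h1
    obtain ⟨O, hO, huO, hsub⟩ := h1
    obtain ⟨δ, hδ, hball⟩ := Metric.isOpen_iff.1 hO u huO
    have hlt : u < min T (u + δ) := lt_min hu.2 (by linarith)
    filter_upwards [Ioo_mem_nhdsGT hlt] with v hv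
    refine key u (min T (u + δ)) F hFc hu.1 (min_le_left _ _) (fun q hq h1 h2 => ?_) v hv.1 hv.2
    refine hsub ⟨hball ?_, h1, hq⟩
    have := h2.trans_le (min_le_right _ _)
    rw [Metric.mem_ball, Real.dist_eq, abs_of_pos (sub_pos.2 h1)]
    linarith
  · intro u hu
    obtain ⟨L, hL⟩ := hl u hu
    refine ⟨L, ?_⟩
    rw [(closed_nhds_basis L).tendsto_right_iff]
    rintro F ⟨hF, hFc⟩
    have h1 := hL hF
    rw [mem_map, mem_nhdsWithin] at h1
    obtain ⟨O, hO, huO, hsub⟩ := h1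
    obtain ⟨δ, hδ, hball⟩ := Metric.isOpen_iff.1 hO u huO
    have hlt : max 0 (u - δ) < u := max_lt hu.1 (by linarith)
    filter_upwards [Ioo_mem_nhdsLT hlt] with v hv
    refine key (max 0 (u - δ)) u F hFc (le_max_left _ _) hu.2 (fun q hq h1 h2 => ?_) v hv.1 hv.2
    refine hsub ⟨hball ?_, h2, hq⟩
    have := (le_max_right _ _).trans_lt h1
    rw [Metric.mem_ball, Real.dist_eq, abs_of_neg (sub_neg.2 h2)]
    linarith

end Paths

section Upcrossings

lemma le_upcrossingsBefore {a b : ℝ} (hab : a < b) {f : ℕ → Ω → ℝ} {ω : Ω} {k N : ℕ} {J : ℕ → ℕ}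
    (hJ : ∀ i, i + 1 < 2 * k → J i < J (i + 1)) (hN : ∀ i < 2 * k, J i < N)
    (hf : ∀ i < k, f (J (2 * i)) ω < a ∧ b < f (J (2 * i + 1)) ω) :
    k ≤ upcrossingsBefore a b f N ω := by
  induction k generalizing N with
  | zero => exact Nat.zero_le _
  | succ k ih =>
    have h1 : k ≤ upcrossingsBefore a b f (J (2 * k)) ω := by
      refine ih (fun i hi => hJ i (by omega)) (fun i hi => ?_) (fun i hi => hf i (by omega))
      have mono : ∀ d, i + d < 2 * (k + 1) → J i + d ≤ J (i + d) := by
        intro d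
        induction d with
        | zero => simp
        | succ d ihd =>
          intro hd
          have := ihd (by omega)
          have := hJ (i + d) (by omega)
          change J i + (d + 1) ≤ J (i + d + 1)
          omega
      have := mono (2 * k - i) (by omega)
      rw [show i + (2 * k - i) = 2 * k by omega] at this
      omega
    have h2 := upcrossingsBefore_lt_of_exists_upcrossing hab le_rfl (hf k (by omega)).1
      (hJ (2 * k) (by omega)).le (hf k (by omega)).2
    have h3 := upcrossingsBefore_mono (f := f) hab
      (show J (2 * k + 1) + 1 ≤ N from hN (2 * k + 1) (by omega)) ω
    dsimp only at h3
    omega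

/-- The grid of mesh `2⁻ⁿ`, stopped at `T`. -/
noncomputable def grid (T : ℝ) (n j : ℕ) : ℝ := min (j / 2 ^ n) T

lemma grid_mono (T : ℝ) (n : ℕ) : Monotone (grid T n) := fun i j hij => by
  unfold grid
  gcongr

lemma grid_mem {T : ℝ} (hT : 0 ≤ T) (n j : ℕ) : grid T n j ∈ Icc 0 T :=
  ⟨le_min (by positivity) hT, min_le_right _ _⟩

lemma dyadic_exists_grid {T x : ℝ} (hx : x ∈ dyadics ∩ Iio T) :
    ∃ n₀, ∀ n ≥ n₀, ∃ j : ℕ, j < ⌈T⌉₊ * 2 ^ n ∧ grid T n j = x := by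
  obtain ⟨⟨n₀, j₀, rfl⟩, hT⟩ := hx
  refine ⟨n₀, fun n hn => ?_⟩
  obtain ⟨d, rfl⟩ := Nat.exists_eq_add_of_le hn
  have e : ((j₀ * 2 ^ d : ℕ) : ℝ) / 2 ^ (n₀ + d) = j₀ / 2 ^ n₀ := by
    rw [pow_add]; push_cast
    field_simp
  have hT' : ((j₀ * 2 ^ d : ℕ) : ℝ) / 2 ^ (n₀ + d) < T := e ▸ hT
  refine ⟨j₀ * 2 ^ d, ?_, ?_⟩
  · have h2 : (0 : ℝ) < 2 ^ (n₀ + d) := by positivity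
    rw [div_lt_iff₀ h2] at hT'
    have := hT'.trans_le (mul_le_mul_of_nonneg_right (Nat.le_ceil T) h2.le)
    exact_mod_cast this
  · rw [grid, e]
    exact min_eq_left (le_of_lt hT)

variable {m0 : MeasurableSpace Ω} {μ : Measure Ω} {T : ℝ} {ℱ : Filtration ℝ m0}

lemma ae_alternatingBound [IsFiniteMeasure μ] (hT : 0 ≤ T) {f : ℝ → Ω → ℝ}
    (hm : ∀ t ∈ Icc 0 T, StronglyMeasurable[ℱ t] (f t))
    (hint : ∀ t ∈ Icc 0 T, Integrable (f t) μ) (hneg : ∀ t ∈ Icc 0 T, ∀ᵐ ω ∂μ, f t ω ≤ 0)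
    (hsub : ∀ s ∈ Icc 0 T, ∀ t ∈ Icc 0 T, s ≤ t → f s ≤ᵐ[μ] μ[f t|ℱ s]) :
    ∀ᵐ ω ∂μ, ∀ a b : ℚ, a < b → AlternatingBound (dyadics ∩ Iio T) (fun t => f t ω) a b := by
  simp only [ae_all_iff]
  intro a b hab
  have hab' : (a : ℝ) < b := by exact_mod_cast hab
  let 𝒢 : ℕ → Filtration ℕ m0 := fun n =>
    ⟨fun j => ℱ (grid T n j), fun i j hij => ℱ.mono (grid_mono T n hij), fun j => ℱ.le _⟩
  have hS : ∀ n, Submartingale (fun j => f (grid T n j)) (𝒢 n) μ := fun n =>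
    ⟨fun j => hm _ (grid_mem hT n j), fun i j hij =>
      hsub _ (grid_mem hT n i) _ (grid_mem hT n j) (grid_mono T n hij),
      fun j => hint _ (grid_mem hT n j)⟩
  let U : ℕ → Ω → ℕ := fun n =>
    upcrossingsBefore (a : ℝ) b (fun j => f (grid T n j)) (⌈T⌉₊ * 2 ^ n)
  have hUm : ∀ n, Measurable fun ω => (U n ω : ℝ≥0∞) := fun n =>
    measurable_from_top.comp ((hS n).stronglyAdapted.measurable_upcrossingsBefore hab')
  have hUb : ∀ n, ∫⁻ ω, (U n ω : ℝ≥0∞) ∂μ ≤ ENNReal.ofReal (|(a : ℝ)| * μ.real univ / (b - a)) := by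
    intro n
    have h1 := (hS n).mul_integral_upcrossingsBefore_le_integral_pos_part (a : ℝ) b (⌈T⌉₊ * 2 ^ n)
    have hUi := (hS n).stronglyAdapted.integrable_upcrossingsBefore (μ := μ) hab' (N := ⌈T⌉₊ * 2 ^ n)
    have h2 : ∫ ω, (f (grid T n (⌈T⌉₊ * 2 ^ n)) ω - a)⁺ ∂μ ≤ ∫ ω, |(a : ℝ)| ∂μ := by
      refine integral_mono_of_nonneg (ae_of_all _ fun ω => posPart_nonneg _)
        (integrable_const _) ?_
      filter_upwards [hneg _ (grid_mem hT n (⌈T⌉₊ * 2 ^ n))] with ω hω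
      refine sup_le ?_ (abs_nonneg _)
      have := neg_abs_le (a : ℝ)
      linarith
    rw [integral_const, smul_eq_mul, mul_comm (μ.real univ)] at h2
    have h3 : ∫ ω, (U n ω : ℝ) ∂μ ≤ |(a : ℝ)| * μ.real univ / (b - a) := by
      rw [le_div_iff₀ (sub_pos.2 hab'), mul_comm]
      exact h1.trans h2
    calc ∫⁻ ω, (U n ω : ℝ≥0∞) ∂μ = ∫⁻ ω, ENNReal.ofReal (U n ω : ℝ) ∂μ := by simp
      _ = ENNReal.ofReal (∫ ω, (U n ω : ℝ) ∂μ) :=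
          (ofReal_integral_eq_lintegral_ofReal hUi (ae_of_all _ fun ω => Nat.cast_nonneg _)).symm
      _ ≤ _ := ENNReal.ofReal_le_ofReal h3
  have hlim : ∫⁻ ω, liminf (fun n => (U n ω : ℝ≥0∞)) atTop ∂μ ≠ ∞ := by
    refine ne_top_of_le_ne_top ENNReal.ofReal_ne_top ((lintegral_liminf_le hUm).trans
      (liminf_le_of_frequently_le' (Frequently.of_forall hUb)))
  filter_upwards [ae_lt_top (Measurable.liminf hUm) hlim] with ω hω
  obtain ⟨k, hk⟩ := ENNReal.exists_nat_gt hω.ne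
  refine ⟨k, fun p hp hmono halt => ?_⟩
  have hgrid : ∀ᶠ n in atTop, ∀ i ∈ Finset.range (2 * k),
      ∃ j : ℕ, j < ⌈T⌉₊ * 2 ^ n ∧ grid T n j = p i := by
    rw [Finset.eventually_all]
    intro i hi
    obtain ⟨n₀, hn₀⟩ := dyadic_exists_grid (hp i (Finset.mem_range.1 hi))
    exact eventually_atTop.2 ⟨n₀, hn₀⟩
  obtain ⟨n, hn1, hn2⟩ := ((frequently_lt_of_liminf_lt (by isBoundedDefault) hk).and_eventually
    hgrid).exists
  have : ∀ i, ∃ j : ℕ, i < 2 * k → j < ⌈T⌉₊ * 2 ^ n ∧ grid T n j = p i := by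
    intro i
    by_cases hi : i < 2 * k
    · obtain ⟨j, hj⟩ := hn2 i (Finset.mem_range.2 hi)
      exact ⟨j, fun _ => hj⟩
    · exact ⟨0, fun h => absurd h hi⟩
  choose J hJ using this
  have hle : k ≤ U n ω := by
    refine le_upcrossingsBefore hab' (J := J) (fun i hi => ?_) (fun i hi => (hJ i hi).1)
      fun i hi => ?_
    · refine (grid_mono T n).reflect_lt ?_
      rw [(hJ i (by omega)).2, (hJ (i + 1) hi).2]
      exact hmono i hi
    · rw [(hJ (2 * i) (by omega)).2, (hJ (2 * i + 1) (by omega)).2]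
      exact halt i hi
  exact absurd (Nat.cast_le.2 hle) (not_le.2 hn1)

end Upcrossings

section MaximalInequality

variable {m0 : MeasurableSpace Ω} {μ : Measure Ω} {T : ℝ} {ℱ : Filtration ℝ m0}
  {Y : ℝ → Ω → ℝ}

lemma SuperMG.measure_exists_lt_le [IsProbabilityMeasure μ] (h : SuperMG μ T ℱ Y) {τ : ℕ → ℝ}
    (hτ : Monotone τ) (hτI : ∀ j, τ j ∈ Icc 0 T) {ε : ℝ} (k : ℕ) :
    μ.withDensity (fun ω => ENNReal.ofReal (Y T ω)) {ω | ∃ j < k, Y (τ j) ω < ε} ≤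
      ENNReal.ofReal ε := by
  have hTI : T ∈ Icc 0 T := ⟨(hτI 0).1.trans (hτI 0).2, le_rfl⟩
  have hE : ∀ j, MeasurableSet[ℱ (τ j)] {ω | Y (τ j) ω < ε} := fun j =>
    measurableSet_lt (h.1.measurable (hτI j)) measurable_const
  have hA : ∀ k j, k ≤ j → MeasurableSet[ℱ (τ j)] {ω | ∃ i < k, Y (τ i) ω < ε} := by
    intro k j hkj
    have : {ω | ∃ i < k, Y (τ i) ω < ε} = ⋃ i ∈ Finset.range k, {ω | Y (τ i) ω < ε} := by
      ext ω; simp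
    rw [this]
    refine Finset.measurableSet_biUnion _ fun i hi => ?_
    have hi' : i ≤ j := (Finset.mem_range.1 hi).le.trans hkj
    exact ℱ.mono (hτ hi') _ (hE i)
  have key : ∀ k, μ.withDensity (fun ω => ENNReal.ofReal (Y T ω)) {ω | ∃ j < k, Y (τ j) ω < ε} ≤
      ENNReal.ofReal ε * μ {ω | ∃ j < k, Y (τ j) ω < ε} := by
    intro k
    induction k with
    | zero => simp
    | succ k ih =>
      set A := {ω | ∃ j < k, Y (τ j) ω < ε} with hAdef
      set E := {ω | Y (τ k) ω < ε} \ A with hEdef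
      have e : {ω | ∃ j < k + 1, Y (τ j) ω < ε} = A ∪ E := by
        ext ω
        simp only [hEdef, hAdef, mem_union, Set.mem_sdiff, mem_ofPred_eq, Nat.lt_succ_iff_lt_or_eq]
        constructor
        · rintro ⟨j, hj | rfl, hj'⟩
          · exact Or.inl ⟨j, hj, hj'⟩
          · by_cases hc : ∃ i < j, Y (τ i) ω < ε
            · exact Or.inl hc
            · exact Or.inr ⟨hj', hc⟩
        · rintro (⟨j, hj, hj'⟩ | ⟨h1, -⟩)
          · exact ⟨j, Or.inl hj, hj'⟩
          · exact ⟨k, Or.inr rfl, h1⟩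
      have hEm : MeasurableSet[ℱ (τ k)] E := (hE k).diff (hA k k le_rfl)
      have hEm' : MeasurableSet E := ℱ.le _ _ hEm
      have hdis : Disjoint A E := disjoint_sdiff_right
      rw [e, measure_union hdis hEm', measure_union hdis hEm', mul_add]
      refine add_le_add ih ?_
      rw [withDensity_apply _ hEm', ← setLIntegral_const]
      refine ((h.condLE (hτI k) hTI (hτI k).2).setLIntegral_le (ℱ.le _) hEm).trans ?_
      refine setLIntegral_mono measurable_const fun ω hω => ENNReal.ofReal_le_ofReal ?_
      exact (show Y (τ k) ω < ε from hω.1).le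
  refine (key k).trans ((mul_le_mul_right prob_le_one _).trans (by simp))

lemma SuperMG.exists_pos_le [IsProbabilityMeasure μ] (hT : 0 ≤ T) (h : SuperMG μ T ℱ Y)
    (hpos : ∀ᵐ ω ∂μ, 0 < Y T ω) :
    ∀ᵐ ω ∂μ, ∃ ε > 0, ∀ q ∈ dyadics ∩ Iio T, ε ≤ Y q ω := by
  set ν := μ.withDensity (fun ω => ENNReal.ofReal (Y T ω)) with hν
  let A : ℕ → ℕ → Set Ω := fun i n => {ω | ∃ j < ⌈T⌉₊ * 2 ^ n, Y (grid T n j) ω < 1 / (i + 1 : ℝ)}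
  have hmono : ∀ i, Monotone (A i) := by
    intro i
    refine monotone_nat_of_le_succ fun n => ?_
    rintro ω ⟨j, hj, hj'⟩
    refine ⟨2 * j, by rw [pow_succ, ← mul_assoc]; omega, ?_⟩
    have : grid T (n + 1) (2 * j) = grid T n j := by
      unfold grid
      congr 1
      rw [pow_succ]; push_cast
      field_simp
    rwa [this]
  have hle : ∀ i, ν (⋃ n, A i n) ≤ ENNReal.ofReal (1 / (i + 1 : ℝ)) := by
    intro i
    rw [(hmono i).measure_iUnion]
    exact iSup_le fun n => h.measure_exists_lt_le (grid_mono T n) (grid_mem hT n) _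
  have hzero : ν (⋂ i, ⋃ n, A i n) = 0 := by
    refine le_antisymm (ge_of_tendsto' (f := fun i : ℕ => ENNReal.ofReal (1 / (i + 1 : ℝ)))
      (x := atTop) ?_ fun i => (measure_mono (iInter_subset _ i)).trans (hle i)) zero_le
    simpa using ENNReal.tendsto_ofReal (tendsto_one_div_add_atTop_nhds_zero_nat (𝕜 := ℝ))
  have hTI : T ∈ Icc 0 T := ⟨hT, le_rfl⟩
  rw [hν, withDensity_apply_eq_zero (h.1.measurable' hTI).ennreal_ofReal] at hzero
  have hzero' : ∀ᵐ ω ∂μ, ω ∉ {ω | ENNReal.ofReal (Y T ω) ≠ 0} ∩ ⋂ i, ⋃ n, A i n :=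
    measure_eq_zero_iff_ae_notMem.1 hzero
  filter_upwards [hzero', hpos] with ω h1 h2
  have h3 : ∃ i, ω ∉ ⋃ n, A i n := by
    by_contra! hc
    exact h1 ⟨by simpa using h2, mem_iInter.2 hc⟩
  obtain ⟨i, hi⟩ := h3
  refine ⟨1 / (i + 1 : ℝ), by positivity, fun q hq => ?_⟩
  obtain ⟨n, hn⟩ := dyadic_exists_grid hq
  obtain ⟨j, hj1, hj2⟩ := hn n le_rfl
  by_contra! hc
  exact hi (mem_iUnion.2 ⟨n, j, hj1, hj2 ▸ hc⟩)

end MaximalInequality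

section Regularization

lemma exists_tendsto_of_mul {S : Set ℝ} {l : Filter ℝ} {y w : ℝ → ℝ} {ε c L : ℝ} (hε : 0 < ε)
    (hS : S ∈ l) (hy : Tendsto y l (𝓝 c)) (hyε : ∀ q ∈ S, ε ≤ y q)
    (hyw : Tendsto (fun q => -(y q * w q)) l (𝓝 L)) : ∃ L', Tendsto w l (𝓝 L') := by
  rcases l.eq_or_neBot with rfl | hne
  · exact ⟨0, tendsto_bot⟩
  · have hc : ε ≤ c := ge_of_tendsto hy (mem_of_superset hS hyε)
    refine ⟨-L / c, (hyw.neg.div hy (hε.trans_le hc).ne').congr' ?_⟩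
    filter_upwards [hS] with q hq
    have := hε.trans_le (hyε q hq)
    simp only [Pi.div_apply, neg_neg]
    field_simp

lemma isBoundedUnder_mul {l : Filter ℝ} {y w : ℝ → ℝ} {c : ℝ} (hy : Tendsto y l (𝓝 c))
    (h0 : ∀ q, 0 ≤ w q) (h1 : ∀ q, w q ≤ 1) :
    IsBoundedUnder (· ≤ ·) l (fun q => -(y q * w q)) ∧
      IsBoundedUnder (· ≥ ·) l (fun q => -(y q * w q)) := by
  have key : ∀ q, |y q * w q| ≤ |y q| := fun q => by
    rw [abs_mul, abs_of_nonneg (h0 q)]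
    exact mul_le_of_le_one_right (abs_nonneg _) (h1 q)
  refine ⟨hy.abs.isBoundedUnder_le.mono_le (Eventually.of_forall fun q => ?_),
    hy.abs.neg.isBoundedUnder_ge.mono_ge (Eventually.of_forall fun q => ?_)⟩
  · exact (neg_le_abs _).trans (key q)
  · exact neg_le_neg ((le_abs_self _).trans (key q))

/-- The smallest dyadic of level `n` that is larger than `u`. -/
noncomputable def dyadicAbove (n : ℕ) (u : ℝ) : ℝ := (⌊u * 2 ^ n⌋₊ + 1 : ℕ) / 2 ^ n

lemma dyadicAbove_mem (n : ℕ) (u : ℝ) : dyadicAbove n u ∈ dyadics := ⟨n, _, rfl⟩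

lemma lt_dyadicAbove (n : ℕ) (u : ℝ) : u < dyadicAbove n u := by
  rw [dyadicAbove, lt_div_iff₀ (by positivity)]
  exact_mod_cast Nat.lt_floor_add_one (u * 2 ^ n)

lemma tendsto_dyadicAbove {u : ℝ} (hu : 0 ≤ u) :
    Tendsto (fun n => dyadicAbove n u) atTop (𝓝 u) := by
  refine tendsto_of_tendsto_of_tendsto_of_le_of_le (g := fun _ => u)
    (h := fun n : ℕ => u + (1 / 2) ^ n) tendsto_const_nhds ?_ (fun n => (lt_dyadicAbove n u).le)
    fun n => ?_
  · simpa using (tendsto_const_nhds (x := u)).add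
      (tendsto_pow_atTop_nhds_zero_of_lt_one (r := (1 / 2 : ℝ)) (by norm_num) (by norm_num))
  · have h2 : (0 : ℝ) < 2 ^ n := by positivity
    have := Nat.floor_le (show 0 ≤ u * 2 ^ n by positivity)
    rw [dyadicAbove, div_le_iff₀ h2, add_mul, one_div, inv_pow, inv_mul_cancel₀ h2.ne']
    push_cast
    linarith

variable {m0 : MeasurableSpace Ω} {μ : Measure Ω} {T : ℝ} {ℱ : Filtration ℝ m0}
  {Y W : ℝ → Ω → ℝ}

/-- Right limits along the dyadics provide a càdlàg regularization of `W` as soon as `Y * W` is a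
supermartingale (without path regularity) for some strictly positive supermartingale `Y`. -/
lemma exists_regularization [IsProbabilityMeasure μ] (hT : 0 < T)
    (hrc : ∀ t : ℝ, (ℱ t : MeasurableSpace Ω) = ⨅ (s : ℝ) (_ : t < s), ℱ s)
    (hY : SuperMG μ T ℱ Y) (hpos : ∀ᵐ ω ∂μ, 0 < Y T ω) (hW0 : ∀ u ω, 0 ≤ W u ω)
    (hW1 : ∀ u ω, W u ω ≤ 1) (hWm : ∀ u, 0 ≤ u → Measurable[ℱ u] (W u))
    (hYW : ∀ u ∈ Icc 0 T, ∀ v ∈ Icc 0 T, u ≤ v → CondLE μ (ℱ u)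
      (fun ω => ENNReal.ofReal (Y v ω * W v ω)) (fun ω => ENNReal.ofReal (Y u ω * W u ω))) :
    ∃ Z : ℝ → Ω → ℝ, PosProc μ T ℱ Z ∧ (∀ u ω, 0 ≤ Z u ω) ∧ (∀ u ω, Z u ω ≤ 1) ∧ Z T = W T ∧
      ∀ u ∈ Ico 0 T, ∃ q : ℕ → ℝ, (∀ n, q n ∈ Ioo u T) ∧ Tendsto q atTop (𝓝 u) ∧
        ∀ᵐ ω ∂μ, Tendsto (fun n => W (q n) ω) atTop (𝓝 (Z u ω)) := by
  have hMm : ∀ t ∈ Icc 0 T, Measurable[ℱ t] fun ω => Y t ω * W t ω := fun t ht =>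
    (hY.1.measurable ht).mul (hWm t ht.1)
  have hMm' : ∀ t ∈ Icc 0 T, Measurable fun ω => Y t ω * W t ω := fun t ht =>
    (hMm t ht).mono (ℱ.le t) le_rfl
  have hM0 : ∀ t ∈ Icc 0 T, ∀ᵐ ω ∂μ, 0 ≤ Y t ω * W t ω := fun t ht => by
    filter_upwards [hY.1.nonneg ht] with ω hω using mul_nonneg hω (hW0 t ω)
  have hMi : ∀ t ∈ Icc 0 T, Integrable (fun ω => Y t ω * W t ω) μ := fun t ht =>
    (hY.2.1 t ht).mul_bdd (c := 1) ((hWm t ht.1).mono (ℱ.le t) le_rfl).aestronglyMeasurable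
      (ae_of_all _ fun ω => by rw [Real.norm_eq_abs, abs_of_nonneg (hW0 t ω)]; exact hW1 t ω)
  have halt := ae_alternatingBound (ℱ := ℱ) (μ := μ) hT.le (f := fun t ω => -(Y t ω * W t ω))
    (fun t ht => (hMm t ht).neg.stronglyMeasurable) (fun t ht => (hMi t ht).neg)
    (fun t ht => by filter_upwards [hM0 t ht] with ω hω using neg_nonpos.2 hω)
    (fun s hs t ht hst => by
      filter_upwards [(hYW s hs t ht hst).condExp_le (ℱ.le s) (hMi t ht) (hMm' t ht) (hM0 t ht)
        (hMm s hs) (hM0 s hs), condExp_neg (fun ω => Y t ω * W t ω) (ℱ s) (μ := μ)] with ω h1 h2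
      exact (neg_le_neg h1).trans h2.ge)
  set S := dyadics ∩ Iio T with hS
  have hright : ∀ᵐ ω ∂μ, ∀ u ∈ Ico 0 T,
      ∃ L, Tendsto (fun q => W q ω) (𝓝[Ioi u ∩ S] u) (𝓝 L) := by
    filter_upwards [halt, hY.exists_pos_le hT.le hpos, hY.1.2.2] with ω h1 ⟨ε, hε, h2⟩ h3 u hu
    have hlim := (h3.1 u hu).mono_left (nhdsWithin_mono u (s := Ioi u ∩ S) inter_subset_left)
    obtain ⟨b1, b2⟩ := isBoundedUnder_mul hlim (fun q => hW0 q ω) (fun q => hW1 q ω)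
    obtain ⟨L, hL⟩ := AlternatingBound.exists_tendsto_right h1 b1 b2
    exact exists_tendsto_of_mul (S := S) hε (mem_of_superset self_mem_nhdsWithin inter_subset_right)
      hlim h2 hL
  have hleft : ∀ᵐ ω ∂μ, ∀ u ∈ Ioc 0 T,
      ∃ L, Tendsto (fun q => W q ω) (𝓝[Iio u ∩ S] u) (𝓝 L) := by
    filter_upwards [halt, hY.exists_pos_le hT.le hpos, hY.1.2.2] with ω h1 ⟨ε, hε, h2⟩ h3 u hu
    obtain ⟨c, hc⟩ := h3.2 u hu
    have hlim := hc.mono_left (nhdsWithin_mono u (s := Iio u ∩ S) inter_subset_left)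
    obtain ⟨b1, b2⟩ := isBoundedUnder_mul hlim (fun q => hW0 q ω) (fun q => hW1 q ω)
    obtain ⟨L, hL⟩ := AlternatingBound.exists_tendsto_left h1 b1 b2
    exact exists_tendsto_of_mul (S := S) hε (mem_of_superset self_mem_nhdsWithin inter_subset_right)
      hlim h2 hL
  let Z : ℝ → Ω → ℝ := fun u ω =>
    if u < T then limsup (fun n => W (dyadicAbove n u) ω) atTop else W T ω
  have hZlt : ∀ u ω, u < T → Z u ω = limsup (fun n => W (dyadicAbove n u) ω) atTop :=
    fun u ω hu => if_pos hu
  have hab : ∀ u ∈ Ico 0 T, Tendsto (fun n => dyadicAbove n u) atTop (𝓝[Ioi u ∩ S] u) := by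
    intro u hu
    refine tendsto_nhdsWithin_iff.2 ⟨tendsto_dyadicAbove hu.1, ?_⟩
    filter_upwards [(tendsto_dyadicAbove hu.1).eventually (Iio_mem_nhds hu.2)] with n hn
    exact ⟨lt_dyadicAbove n u, dyadicAbove_mem n u, hn⟩
  have hZlim : ∀ᵐ ω ∂μ, ∀ u ∈ Ico 0 T,
      Tendsto (fun q => W q ω) (𝓝[Ioi u ∩ S] u) (𝓝 (Z u ω)) := by
    filter_upwards [hright] with ω hω u hu
    obtain ⟨L, hL⟩ := hω u hu
    have e : Z u ω = L := (hZlt u ω hu.2).trans (hL.comp (hab u hu)).limsup_eq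
    rwa [e]
  have hbdd : ∀ u ω, IsBoundedUnder (· ≤ ·) atTop (fun n => W (dyadicAbove n u) ω) := fun u ω =>
    isBoundedUnder_of ⟨1, fun n => hW1 _ ω⟩
  have hbdd' : ∀ u ω, IsBoundedUnder (· ≥ ·) atTop (fun n => W (dyadicAbove n u) ω) := fun u ω =>
    isBoundedUnder_of ⟨0, fun n => hW0 _ ω⟩
  have hZ0 : ∀ u ω, 0 ≤ Z u ω := by
    intro u ω
    simp only [Z]
    split_ifs
    · exact le_limsup_of_frequently_le (Frequently.of_forall fun n => hW0 _ ω) (hbdd u ω)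
    · exact hW0 T ω
  have hZ1 : ∀ u ω, Z u ω ≤ 1 := by
    intro u ω
    simp only [Z]
    split_ifs
    · exact limsup_le_of_le (hbdd' u ω).isCoboundedUnder_le (Eventually.of_forall fun n => hW1 _ ω)
    · exact hW1 T ω
  have hZm : ∀ u ∈ Icc 0 T, Measurable[ℱ u] (Z u) := by
    intro u hu
    by_cases huT : u < T
    · have hs : ∀ s, u < s → Measurable[ℱ s] (Z u) := by
        intro s hs
        obtain ⟨N, hN⟩ := eventually_atTop.1
          ((tendsto_dyadicAbove hu.1).eventually (Iio_mem_nhds hs))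
        have e : Z u = fun ω => limsup (fun n => W (dyadicAbove (n + N) u) ω) atTop := by
          ext ω
          rw [hZlt u ω huT, ← limsup_nat_add _ N]
        rw [e]
        refine Measurable.limsup fun n => ?_
        have h1 : 0 ≤ dyadicAbove (n + N) u := hu.1.trans (lt_dyadicAbove _ u).le
        exact (hWm _ h1).mono (ℱ.mono (le_of_lt (hN (n + N) (Nat.le_add_left _ _)))) le_rfl
      intro B hB
      rw [hrc u]
      simp only [MeasurableSpace.measurableSet_iInf]
      exact fun s hus => hs s hus hB
    · have : u = T := le_antisymm hu.2 (not_lt.1 huT)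
      subst this
      have : Z u = W u := by ext ω; simp [Z]
      rw [this]
      exact hWm u hu.1
  refine ⟨Z, ⟨fun t ht => (hZm t ht).stronglyMeasurable, ae_of_all _ fun ω t _ => hZ0 t ω, ?_⟩,
    hZ0, hZ1, by ext ω; simp [Z], ?_⟩
  · filter_upwards [hZlim, hleft] with ω h1 h2
    refine cadlagOn_of_tendsto (S := S) (fun x y hx hxy hy => ?_) h1 h2
    obtain ⟨q, hq, h3, h4⟩ := exists_dyadic_btwn hx hxy
    exact ⟨q, ⟨hq, h4.trans_le hy⟩, h3, h4⟩
  · intro u hu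
    obtain ⟨N, hN⟩ := eventually_atTop.1
      ((tendsto_dyadicAbove hu.1).eventually (Iio_mem_nhds hu.2))
    refine ⟨fun n => dyadicAbove (n + N) u,
      fun n => ⟨lt_dyadicAbove _ u, hN (n + N) (Nat.le_add_left _ _)⟩,
      (tendsto_add_atTop_iff_nat N).2 (tendsto_dyadicAbove hu.1), ?_⟩
    filter_upwards [hZlim] with ω hω
    exact ((hω u hu).comp (hab u hu)).comp (tendsto_add_atTop_nat N)

end Regularization

section EssentialSupremum

variable {m0 : MeasurableSpace Ω} {μ : Measure Ω}

lemma exists_seq_iSup_ae_ge {𝓕 : Set (Ω → ℝ≥0∞)} (hne : 𝓕.Nonempty)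
    (hm : ∀ f ∈ 𝓕, Measurable f)
    (hdir : ∀ f ∈ 𝓕, ∀ g ∈ 𝓕, ∃ h ∈ 𝓕, f ≤ᵐ[μ] h ∧ g ≤ᵐ[μ] h) {c : ℝ≥0∞} (hc : c ≠ ∞)
    (hbdd : ∀ f ∈ 𝓕, ∫⁻ ω, f ω ∂μ ≤ c) :
    ∃ F : ℕ → Ω → ℝ≥0∞, (∀ n, F n ∈ 𝓕) ∧ (∀ n, F n ≤ᵐ[μ] F (n + 1)) ∧
      ∀ f ∈ 𝓕, ∀ᵐ ω ∂μ, f ω ≤ ⨆ n, F n ω := by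
  set S := ⨆ f : 𝓕, ∫⁻ ω, f.1 ω ∂μ with hS
  have hSc : S ≤ c := iSup_le fun f => hbdd f f.2
  have := hne.to_subtype
  obtain ⟨v, -, hvlim, hv⟩ := exists_seq_tendsto_sSup
    (range_nonempty fun f : 𝓕 => ∫⁻ ω, f.1 ω ∂μ) (OrderTop.bddAbove _)
  rw [sSup_range, ← hS] at hvlim
  choose G hG using hv
  have hdir' : ∀ f g : 𝓕, ∃ h : 𝓕, f.1 ≤ᵐ[μ] h.1 ∧ g.1 ≤ᵐ[μ] h.1 := fun f g => by
    obtain ⟨h, hh, h1⟩ := hdir f f.2 g g.2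
    exact ⟨⟨h, hh⟩, h1⟩
  choose sup hsup using hdir'
  let F : ℕ → 𝓕 := fun n => Nat.rec (G 0) (fun n f => sup f (G (n + 1))) n
  have hmono : ∀ n, (F n).1 ≤ᵐ[μ] (F (n + 1)).1 := fun n => (hsup (F n) (G (n + 1))).1
  have hGF : ∀ n, (G n).1 ≤ᵐ[μ] (F n).1 := by
    intro n
    cases n with
    | zero => exact ae_of_all _ fun _ => le_rfl
    | succ n => exact (hsup (F n) (G (n + 1))).2
  refine ⟨fun n => (F n).1, fun n => (F n).2, hmono, fun f hf => ?_⟩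
  have hFm : ∀ n, Measurable (F n).1 := fun n => hm _ (F n).2
  set N : Ω → ℝ≥0∞ := fun ω => ⨆ n, (F n).1 ω with hN
  have hNm : Measurable N := Measurable.iSup hFm
  have hNS : S ≤ ∫⁻ ω, N ω ∂μ := by
    refine le_of_tendsto' hvlim fun n => ?_
    rw [← hG n]
    exact lintegral_mono_ae ((hGF n).mono fun ω h => h.trans (le_iSup (fun n => (F n).1 ω) n))
  have hmax : ∫⁻ ω, max (f ω) (N ω) ∂μ ≤ S := by
    have e : ∀ ω, max (f ω) (N ω) = ⨆ n, max (f ω) ((F n).1 ω) := fun ω => by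
      rw [hN]; exact sup_iSup
    simp only [e]
    rw [lintegral_iSup_ae (fun n => (hm f hf).max (hFm n))
      fun n => (hmono n).mono fun ω h => max_le_max le_rfl h]
    refine iSup_le fun n => ?_
    have h1 := hsup ⟨f, hf⟩ (F n)
    refine (lintegral_mono_ae ?_).trans (le_iSup (fun f : 𝓕 => ∫⁻ ω, f.1 ω ∂μ) (sup ⟨f, hf⟩ (F n)))
    filter_upwards [h1.1, h1.2] with ω h2 h3 using max_le h2 h3
  have hfin : ∫⁻ ω, N ω ∂μ ≠ ∞ := by
    refine ne_top_of_le_ne_top hc (le_trans ?_ (hmax.trans hSc))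
    exact lintegral_mono fun ω => le_max_right _ _
  have := ae_eq_of_ae_le_of_lintegral_le (μ := μ) (f := N) (g := fun ω => max (f ω) (N ω))
    (ae_of_all _ fun ω => le_max_right _ _) hfin ((hm f hf).max hNm).aemeasurable (hmax.trans hNS)
  filter_upwards [this] with ω hω
  have h' : N ω = max (f ω) (N ω) := hω
  exact (le_max_left (f ω) (N ω)).trans h'.ge

end EssentialSupremum

section DualBound

variable {m0 : MeasurableSpace Ω} {μ : Measure Ω} {T : ℝ} {ℱ : Filtration ℝ m0}
  {D : Set (ℝ → Ω → ℝ)} {Y1 Y2 Ys : ℝ → Ω → ℝ}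

/-- The process which follows `Y1` until time `s` and then evolves proportionally to `Y2`. -/
noncomputable def switch (s : ℝ) (Y1 Y2 : ℝ → Ω → ℝ) : ℝ → Ω → ℝ := fork s (fun _ => 1) Y1 Y2 Y2

lemma switch_of_lt {s t : ℝ} (hst : t < s) : switch s Y1 Y2 t = Y1 t := fork_of_lt _ hst

lemma switch_of_le {s t : ℝ} (hst : s ≤ t) (ω : Ω) :
    switch s Y1 Y2 t ω = Y1 s ω * (Y2 t ω / Y2 s ω) := by
  rw [switch, fork_of_le _ hst]; ring

lemma ForkConvex.switch_mem (h : ForkConvex μ T ℱ D) {s : ℝ} (hs : s ∈ Icc 0 T) (h1 : Y1 ∈ D)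
    (h2 : Y2 ∈ D) : switch s Y1 Y2 ∈ D :=
  h s hs (fun _ => 1) stronglyMeasurable_const (fun _ => zero_le_one) (fun _ => le_rfl)
    Y1 h1 Y2 h2 Y2 h2

lemma le_mul_div_of_le {a b c : ℝ} (hc : 0 ≤ c) (hb : 0 ≤ b) (hab : b ≤ a) (h0 : b = 0 → c = 0) :
    c ≤ a * (c / b) := by
  rcases hb.eq_or_lt with hb' | hb'
  · simp [h0 hb'.symm]
  · rw [mul_div_assoc', le_div_iff₀ hb', mul_comm]
    gcongr

lemma exists_dual_bound [IsProbabilityMeasure μ] (hD : ∀ X ∈ D, S1mem μ T ℱ X)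
    (hF : ForkConvex μ T ℱ D) (hYs : Ys ∈ D) (hpos : ∀ᵐ ω ∂μ, 0 < Ys T ω) {u t : ℝ}
    (hu : u ∈ Icc 0 T) (ht : t ∈ Icc 0 T) (hut : u ≤ t) {g : Ω → ℝ} (hg : Measurable g)
    (hg0 : ∀ ω, 0 ≤ g ω) (hg1 : ∀ ω, g ω ≤ 1) :
    ∃ ζ : Ω → ℝ, Measurable[ℱ u] ζ ∧ (∀ ω, 0 ≤ ζ ω) ∧ (∀ ω, ζ ω ≤ 1) ∧
      (∀ Y ∈ D, CondLE μ (ℱ u) (fun ω => ENNReal.ofReal (Y t ω * g ω))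
        (fun ω => ENNReal.ofReal (Y u ω * ζ ω))) ∧
      ∃ Yn : ℕ → ℝ → Ω → ℝ, (∀ n, Yn n ∈ D) ∧ (∀ n, Yn n u ≤ᵐ[μ] Ys u) ∧
        ∀ φ : Ω → ℝ≥0∞, Measurable[ℱ u] φ → ∫⁻ ω, φ ω * ENNReal.ofReal (Ys u ω * ζ ω) ∂μ ≤
          ⨆ n, ∫⁻ ω, φ ω * ENNReal.ofReal (Yn n t ω * g ω) ∂μ := by
  have hle := ℱ.le u
  set ξ : (ℝ → Ω → ℝ) → Ω → ℝ≥0∞ := fun Y => μ⁻[fun ω => ENNReal.ofReal (Y t ω * g ω)|ℱ u]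
    with hξ
  have hYgm : ∀ Y ∈ D, Measurable fun ω => ENNReal.ofReal (Y t ω * g ω) := fun Y hY =>
    (((hD Y hY).1.1.measurable' ht).mul hg).ennreal_ofReal
  have hξm : ∀ Y, Measurable[ℱ u] (ξ Y) := fun Y => measurable_condLExp _ _ _
  have hξm' : ∀ Y, Measurable (ξ Y) := fun Y => (hξm Y).mono hle le_rfl
  have hYs1 := (hD Ys hYs).1
  have hpu := hYs1.pos hpos hu
  have hξle : ∀ Y ∈ D, Y u ≤ᵐ[μ] Ys u → ξ Y ≤ᵐ[μ] fun ω => ENNReal.ofReal (Ys u ω) := by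
    intro Y hY hYu
    have hY1 := (hD Y hY).1
    have h1 : CondLE μ (ℱ u) (ξ Y) (fun ω => ENNReal.ofReal (Y t ω)) :=
      (condLExp_condLE hle (hYgm Y hY)).trans_ae (by
        filter_upwards [hY1.1.nonneg ht] with ω h2
        exact ENNReal.ofReal_le_ofReal (mul_le_of_le_one_right h2 (hg1 ω)))
    filter_upwards [(h1.trans (hY1.condLE hu ht hut) le_rfl).ae_le hle
      (hY1.1.measurable hu).ennreal_ofReal (hξm Y), hYu] with ω h2 h3
    exact h2.trans (ENNReal.ofReal_le_ofReal h3)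
  let 𝓕 : Set (Ω → ℝ≥0∞) := {f | ∃ Y ∈ D, Y u ≤ᵐ[μ] Ys u ∧ f = ξ Y}
  have hdir : ∀ f ∈ 𝓕, ∀ g ∈ 𝓕, ∃ h ∈ 𝓕, f ≤ᵐ[μ] h ∧ g ≤ᵐ[μ] h := by
    rintro _ ⟨Y1, hY1, hY1u, rfl⟩ _ ⟨Y2, hY2, hY2u, rfl⟩
    have hA : MeasurableSet[ℱ u] {ω | ξ Y2 ω ≤ ξ Y1 ω} := measurableSet_le (hξm Y2) (hξm Y1)
    set A := {ω | ξ Y2 ω ≤ ξ Y1 ω} with hAdef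
    set h : Ω → ℝ := A.indicator fun _ => 1 with hh
    have hhm : StronglyMeasurable[ℱ u] h := stronglyMeasurable_const.indicator hA
    have hh0 : ∀ ω, 0 ≤ h ω := fun ω => indicator_nonneg (fun _ _ => zero_le_one) ω
    have hh1 : ∀ ω, h ω ≤ 1 := fun ω => indicator_le_self' (fun _ _ => zero_le_one) ω
    have hY3 : fork u h Ys Y1 Y2 ∈ D := hF u hu h hhm hh0 hh1 Ys hYs Y1 hY1 Y2 hY2
    have hY3u : fork u h Ys Y1 Y2 u ≤ᵐ[μ] Ys u := by
      filter_upwards [hpu] with ω h1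
      rw [fork_of_le h le_rfl]
      simpa using fork_self_le (w := 1) h1.le (hh0 ω) (hh1 ω) (mul_one _).symm zero_le_one
    refine ⟨_, ⟨_, hY3, hY3u, rfl⟩, ?_⟩
    have hψ1 : Measurable[ℱ u] fun ω => ENNReal.ofReal (h ω) := hhm.measurable.ennreal_ofReal
    have hψ2 : Measurable[ℱ u] fun ω => ENNReal.ofReal (1 - h ω) :=
      (measurable_const.sub hhm.measurable).ennreal_ofReal
    have hsum : CondLE μ (ℱ u) (fun ω => ENNReal.ofReal (h ω) * ξ Y1 ω +
        ENNReal.ofReal (1 - h ω) * ξ Y2 ω) (ξ (fork u h Ys Y1 Y2)) := by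
      refine CondLE.trans (CondLE.trans_ae (((condLExp_condLE hle (hYgm Y1 hY1)).mul hψ1).add
        ((condLExp_condLE hle (hYgm Y2 hY2)).mul hψ2) hle
          ((hψ1.mono hle le_rfl).mul (hYgm Y1 hY1)) ((hψ1.mono hle le_rfl).mul (hξm' Y1))) ?_)
        (condLE_condLExp hle (hYgm _ hY3)) le_rfl
      filter_upwards [(hD Y1 hY1).1.1.nonneg ht, (hD Y2 hY2).1.1.nonneg ht,
        (hD Y1 hY1).1.1.nonneg hu, (hD Y2 hY2).1.1.nonneg hu, hY1u, hY2u,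
        (hD Y1 hY1).1.eq_zero hu ht hut, (hD Y2 hY2).1.eq_zero hu ht hut]
        with ω k1 k2 k3 k4 k5 k6 k7 k8
      have p0 := hh0 ω
      have p1 := sub_nonneg.2 (hh1 ω)
      have pg := hg0 ω
      rw [← ENNReal.ofReal_mul p0, ← ENNReal.ofReal_mul p1,
        ← ENNReal.ofReal_add (by positivity) (by positivity), fork_of_le h hut]
      refine ENNReal.ofReal_le_ofReal ?_
      have q1 := mul_le_mul_of_nonneg_left (le_mul_div_of_le k1 k3 k5 k7) (mul_nonneg p0 pg)
      have q2 := mul_le_mul_of_nonneg_left (le_mul_div_of_le k2 k4 k6 k8) (mul_nonneg p1 pg)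
      linarith
    have hae := hsum.ae_le hle (hξm _) ((hψ1.mul (hξm Y1)).add (hψ2.mul (hξm Y2)))
    constructor <;> filter_upwards [hae] with ω hω <;> refine le_trans ?_ hω <;>
      by_cases hωA : ω ∈ A
    · simp [hh, hωA]
    · have : ξ Y1 ω ≤ ξ Y2 ω := (not_le.1 hωA).le
      simpa [hh, hωA]
    · have : ξ Y2 ω ≤ ξ Y1 ω := hωA
      simpa [hh, hωA]
    · simp [hh, hωA]
  obtain ⟨F, hF1, hF2, hF3⟩ := exists_seq_iSup_ae_ge (μ := μ) (𝓕 := 𝓕)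
    ⟨_, Ys, hYs, EventuallyLE.refl _ _, rfl⟩ (by rintro _ ⟨Y, -, -, rfl⟩; exact hξm' Y) hdir
    (c := ∫⁻ ω, ENNReal.ofReal (Ys u ω) ∂μ)
    (by rw [← lt_top_iff_ne_top, ← hasFiniteIntegral_iff_ofReal (hYs1.1.nonneg hu)]
        exact (hYs1.2.1 u hu).2)
    (by rintro _ ⟨Y, hY, hYu, rfl⟩; exact lintegral_mono_ae (hξle Y hY hYu))
  choose Yn hYn hYnu hYnξ using hF1
  set N : Ω → ℝ≥0∞ := fun ω => ⨆ n, F n ω with hN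
  have hFm : ∀ n, Measurable[ℱ u] (F n) := fun n => by rw [hYnξ n]; exact hξm _
  have hNm : Measurable[ℱ u] N := Measurable.iSup hFm
  have hNle : N ≤ᵐ[μ] fun ω => ENNReal.ofReal (Ys u ω) := by
    have : ∀ᵐ ω ∂μ, ∀ n, F n ω ≤ ENNReal.ofReal (Ys u ω) :=
      ae_all_iff.2 fun n => by rw [hYnξ n]; exact hξle _ (hYn n) (hYnu n)
    filter_upwards [this] with ω hω using iSup_le hω
  set ζ : Ω → ℝ := fun ω => min 1 (N ω / ENNReal.ofReal (Ys u ω)).toReal with hζ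
  have hζm : Measurable[ℱ u] ζ := Measurable.min measurable_const
    (Measurable.ennreal_toReal (hNm.div (hYs1.1.measurable hu).ennreal_ofReal))
  have hζ0 : ∀ ω, 0 ≤ ζ ω := fun ω => le_min zero_le_one ENNReal.toReal_nonneg
  have hζN : (fun ω => ENNReal.ofReal (Ys u ω * ζ ω)) =ᵐ[μ] N := by
    filter_upwards [hNle, hpu] with ω h1 h2
    have hy0 : ENNReal.ofReal (Ys u ω) ≠ 0 := by simpa using h2
    have hd : N ω / ENNReal.ofReal (Ys u ω) ≤ 1 := ENNReal.div_le_of_le_mul (by simpa using h1)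
    have hd' : (N ω / ENNReal.ofReal (Ys u ω)).toReal ≤ 1 := by
      simpa using ENNReal.toReal_mono ENNReal.one_ne_top hd
    rw [ENNReal.ofReal_mul h2.le, hζ]
    simp only [min_eq_right hd']
    rw [ENNReal.ofReal_toReal (ne_top_of_le_ne_top ENNReal.one_ne_top hd),
      ENNReal.mul_div_cancel hy0 ENNReal.ofReal_ne_top]
  refine ⟨ζ, hζm, hζ0, fun ω => min_le_left _ _, fun Y hY => ?_, Yn, hYn, hYnu, fun φ hφ => ?_⟩
  · have hY1 := (hD Y hY).1
    have hS : switch u Ys Y ∈ D := hF.switch_mem hu hYs hY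
    have hSu : switch u Ys Y u ≤ᵐ[μ] Ys u := by
      filter_upwards [hpu] with ω h1
      rw [switch_of_le le_rfl]
      exact mul_le_of_le_one_right h1.le (div_self_le_one _)
    have hψ : Measurable[ℱ u] fun ω => ENNReal.ofReal (Y u ω / Ys u ω) :=
      ((hY1.1.measurable hu).div (hYs1.1.measurable hu)).ennreal_ofReal
    have h1 : CondLE μ (ℱ u) (fun ω => ENNReal.ofReal (switch u Ys Y t ω * g ω))
        (fun ω => ENNReal.ofReal (Ys u ω * ζ ω)) := by
      refine (condLE_condLExp hle (hYgm _ hS)).trans_ae ?_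
      filter_upwards [hζN, hF3 _ ⟨_, hS, hSu, rfl⟩] with ω h2 h3
      rw [h2]
      exact h3
    refine CondLE.ae_trans ?_ ((h1.mul hψ).trans_ae ?_)
    · filter_upwards [hpu, hY1.1.nonneg hu, hY1.1.nonneg ht, hY1.eq_zero hu ht hut]
        with ω k1 k2 k3 k4
      rw [← ENNReal.ofReal_mul (by positivity), switch_of_le hut]
      refine ENNReal.ofReal_le_ofReal ?_
      have := mul_le_mul_of_nonneg_right (le_mul_div_of_le k3 k2 le_rfl k4) (hg0 ω)
      have e : Y u ω / Ys u ω * (Ys u ω * (Y t ω / Y u ω) * g ω) = Y u ω * (Y t ω / Y u ω) * g ω := by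
        field_simp
      rwa [e]
    · filter_upwards [hpu, hY1.1.nonneg hu] with ω k1 k2
      rw [← ENNReal.ofReal_mul (by positivity)]
      refine ENNReal.ofReal_le_ofReal (le_of_eq ?_)
      field_simp
  · have hφ' := hφ.mono hle le_rfl
    calc ∫⁻ ω, φ ω * ENNReal.ofReal (Ys u ω * ζ ω) ∂μ = ∫⁻ ω, ⨆ n, φ ω * F n ω ∂μ := by
          refine lintegral_congr_ae ?_
          filter_upwards [hζN] with ω hω
          rw [hω, hN, ENNReal.mul_iSup]
      _ = ⨆ n, ∫⁻ ω, φ ω * F n ω ∂μ := by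
          refine lintegral_iSup_ae (fun n => hφ'.mul ((hFm n).mono hle le_rfl)) fun n => ?_
          filter_upwards [hF2 n] with ω hω
          gcongr
      _ ≤ _ := by
          refine iSup_mono fun n => ?_
          rw [hYnξ n]
          exact condLExp_condLE hle (hYgm _ (hYn n)) φ hφ

end DualBound

section DualProc

variable {m0 : MeasurableSpace Ω} {μ : Measure Ω} {T : ℝ} {ℱ : Filtration ℝ m0}
  {D : Set (ℝ → Ω → ℝ)} {Ys X : ℝ → Ω → ℝ}

lemma exists_dual_family [IsProbabilityMeasure μ] (hD : ∀ X ∈ D, S1mem μ T ℱ X)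
    (hF : ForkConvex μ T ℱ D) (hYs : Ys ∈ D) (hpos : ∀ᵐ ω ∂μ, 0 < Ys T ω) {t : ℝ}
    (ht : t ∈ Icc 0 T) {g : Ω → ℝ} (hg : Measurable[ℱ t] g)
    (hg0 : ∀ ω, 0 ≤ g ω) (hg1 : ∀ ω, g ω ≤ 1) :
    ∃ W : ℝ → Ω → ℝ, (∀ u ω, 0 ≤ W u ω) ∧ (∀ u ω, W u ω ≤ 1) ∧
      (∀ u, 0 ≤ u → Measurable[ℱ u] (W u)) ∧ (∀ u, t ≤ u → W u = g) ∧
      (∀ Y ∈ D, ∀ u ∈ Icc 0 T, ∀ v ∈ Icc 0 T, u ≤ v → CondLE μ (ℱ u)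
        (fun ω => ENNReal.ofReal (Y v ω * W v ω)) (fun ω => ENNReal.ofReal (Y u ω * W u ω))) ∧
      ∀ u ∈ Ico 0 t, ∃ Yn : ℕ → ℝ → Ω → ℝ, (∀ n, Yn n ∈ D) ∧ (∀ n, Yn n u ≤ᵐ[μ] Ys u) ∧
        ∀ φ : Ω → ℝ≥0∞, Measurable[ℱ u] φ → ∫⁻ ω, φ ω * ENNReal.ofReal (Ys u ω * W u ω) ∂μ ≤
          ⨆ n, ∫⁻ ω, φ ω * ENNReal.ofReal (Yn n t ω * g ω) ∂μ := by
  have hgm : Measurable g := hg.mono (ℱ.le t) le_rfl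
  have hI : ∀ u ∈ Ico 0 t, u ∈ Icc 0 T := fun u hu => ⟨hu.1, hu.2.le.trans ht.2⟩
  have H : ∀ u : ℝ, ∃ ζ : Ω → ℝ, (∀ ω, 0 ≤ ζ ω) ∧ (∀ ω, ζ ω ≤ 1) ∧ (u ∈ Ico 0 t →
      Measurable[ℱ u] ζ ∧
      (∀ Y ∈ D, CondLE μ (ℱ u) (fun ω => ENNReal.ofReal (Y t ω * g ω))
        (fun ω => ENNReal.ofReal (Y u ω * ζ ω))) ∧
      ∃ Yn : ℕ → ℝ → Ω → ℝ, (∀ n, Yn n ∈ D) ∧ (∀ n, Yn n u ≤ᵐ[μ] Ys u) ∧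
        ∀ φ : Ω → ℝ≥0∞, Measurable[ℱ u] φ → ∫⁻ ω, φ ω * ENNReal.ofReal (Ys u ω * ζ ω) ∂μ ≤
          ⨆ n, ∫⁻ ω, φ ω * ENNReal.ofReal (Yn n t ω * g ω) ∂μ) := by
    intro u
    by_cases hu : u ∈ Ico 0 t
    · obtain ⟨ζ, h1, h2, h3, h4, h5⟩ :=
        exists_dual_bound hD hF hYs hpos (hI u hu) ht hu.2.le hgm hg0 hg1
      exact ⟨ζ, h2, h3, fun _ => ⟨h1, h4, h5⟩⟩
    · exact ⟨fun _ => 0, fun _ => le_rfl, fun _ => zero_le_one, fun h => absurd h hu⟩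
  choose ζ hζ0 hζ1 hζ using H
  set W : ℝ → Ω → ℝ := fun u => if t ≤ u then g else ζ u with hW
  have hWt : ∀ u, t ≤ u → W u = g := fun u hu => if_pos hu
  have hWu : ∀ u, u < t → W u = ζ u := fun u hu => if_neg hu.not_ge
  refine ⟨W, fun u => ?_, fun u => ?_, fun u hu => ?_, hWt, ?_, fun u hu => ?_⟩
  · rcases le_or_gt t u with h | h
    · rw [hWt u h]; exact hg0
    · rw [hWu u h]; exact hζ0 u
  · rcases le_or_gt t u with h | h
    · rw [hWt u h]; exact hg1
    · rw [hWu u h]; exact hζ1 u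
  · rcases le_or_gt t u with h | h
    · rw [hWt u h]; exact hg.mono (ℱ.mono h) le_rfl
    · rw [hWu u h]; exact (hζ u ⟨hu, h⟩).1
  · have key : ∀ Y ∈ D, ∀ u ∈ Icc 0 T, ∀ v ∈ Icc 0 T, t ≤ u → u ≤ v → CondLE μ (ℱ u)
        (fun ω => ENNReal.ofReal (Y v ω * g ω)) (fun ω => ENNReal.ofReal (Y u ω * g ω)) := by
      intro Y hY u hu v hv htu huv
      simp_rw [ENNReal.ofReal_mul' (hg0 _), mul_comm _ (ENNReal.ofReal (g _))]
      exact ((hD Y hY).1.condLE hu hv huv).mul (hg.mono (ℱ.mono htu) le_rfl).ennreal_ofReal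
    intro Y hY u hu v hv huv
    rcases le_or_gt t u with h | h
    · rw [hWt u h, hWt v (h.trans huv)]
      exact key Y hY u hu v hv h huv
    rw [hWu u h]
    rcases le_or_gt t v with h' | h'
    · rw [hWt v h']
      exact (key Y hY t ht v hv le_rfl h').trans ((hζ u ⟨hu.1, h⟩).2.1 Y hY) (ℱ.mono h.le)
    rw [hWu v h']
    rcases huv.eq_or_lt with rfl | huv
    · exact fun φ _ => le_rfl
    intro φ hφ
    obtain ⟨-, -, Yn, hYn, hYnv, hYnφ⟩ := hζ v ⟨hv.1, h'⟩
    have hYm := (hD Y hY).1.1.measurable hv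
    have hYsm := (hD Ys hYs).1.1.measurable hv
    have hpv := (hD Ys hYs).1.pos hpos hv
    calc ∫⁻ ω, φ ω * ENNReal.ofReal (Y v ω * ζ v ω) ∂μ
        = ∫⁻ ω, (φ ω * ENNReal.ofReal (Y v ω / Ys v ω)) *
            ENNReal.ofReal (Ys v ω * ζ v ω) ∂μ := by
          refine lintegral_congr_ae ?_
          filter_upwards [hpv, (hD Y hY).1.1.nonneg hv] with ω h1 h2
          rw [mul_assoc, ← ENNReal.ofReal_mul (by positivity)]
          congr 2
          field_simp
      _ ≤ ⨆ n, ∫⁻ ω, (φ ω * ENNReal.ofReal (Y v ω / Ys v ω)) *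
            ENNReal.ofReal (Yn n t ω * g ω) ∂μ :=
          hYnφ _ ((hφ.mono (ℱ.mono huv.le) le_rfl).mul (hYm.div hYsm).ennreal_ofReal)
      _ ≤ ∫⁻ ω, φ ω * ENNReal.ofReal (Y u ω * ζ u ω) ∂μ := by
          refine iSup_le fun n => ?_
          have hS := hF.switch_mem hv hY (hYn n)
          have hd := (hζ u ⟨hu.1, h⟩).2.1 _ hS φ hφ
          rw [switch_of_lt huv] at hd
          refine le_trans (lintegral_mono_ae ?_) hd
          have hn := (hD _ (hYn n)).1
          filter_upwards [hpv, (hD Y hY).1.1.nonneg hv, hn.1.nonneg hv, hn.1.nonneg ht,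
            hn.eq_zero hv ht h'.le, hYnv n] with ω k1 k2 k3 k4 k5 k6
          rw [mul_assoc, ← ENNReal.ofReal_mul (by positivity), switch_of_le h'.le]
          refine mul_le_mul_right (ENNReal.ofReal_le_ofReal ?_) _
          rw [← mul_assoc]
          refine mul_le_mul_of_nonneg_right ?_ (hg0 ω)
          have := mul_le_mul_of_nonneg_left (le_mul_div_of_le k4 k3 k6 k5)
            (div_nonneg k2 k1.le)
          refine this.trans (le_of_eq ?_)
          field_simp
  · rw [hWu u hu.2]
    exact (hζ u hu).2.2

lemma exists_dual_proc [IsProbabilityMeasure μ] (hT : 0 < T)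
    (hrc : ∀ t : ℝ, (ℱ t : MeasurableSpace Ω) = ⨅ (s : ℝ) (_ : t < s), ℱ s)
    (hD : ∀ X ∈ D, S1mem μ T ℱ X)
    (hF : ForkConvex μ T ℱ D) (hYs : Ys ∈ D) (hpos : ∀ᵐ ω ∂μ, 0 < Ys T ω) {t : ℝ}
    (ht : t ∈ Icc 0 T) {g : Ω → ℝ} (hg : Measurable[ℱ t] g)
    (hg0 : ∀ ω, 0 ≤ g ω) (hg1 : ∀ ω, g ω ≤ 1) :
    ∃ Z ∈ procPolar μ T ℱ D, (∀ u ω, 0 ≤ Z u ω) ∧ Z t =ᵐ[μ] g ∧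
      ∀ u ∈ Ico 0 t, ∃ Yn : ℕ → ℝ → Ω → ℝ, (∀ n, Yn n ∈ D) ∧ (∀ n, Yn n u ≤ᵐ[μ] Ys u) ∧
        ∀ φ : Ω → ℝ≥0∞, Measurable[ℱ u] φ → ∫⁻ ω, φ ω * ENNReal.ofReal (Ys u ω * Z u ω) ∂μ ≤
          ⨆ n, ∫⁻ ω, φ ω * ENNReal.ofReal (Yn n t ω * g ω) ∂μ := by
  obtain ⟨W, hW0, hW1, hWm, hWt, hYW, hWn⟩ := exists_dual_family hD hF hYs hpos ht hg hg0 hg1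
  obtain ⟨Z, hZ, hZ0, hZ1, hZT, hZq⟩ := exists_regularization hT hrc (hD Ys hYs).1 hpos hW0 hW1 hWm
    (hYW Ys hYs)
  have hseq : ∀ u ∈ Icc 0 T, ∃ q : ℕ → ℝ, (∀ n, q n ∈ Icc u T) ∧ Tendsto q atTop (𝓝 u) ∧
      (∀ v ∈ Icc 0 T, u < v → ∀ᶠ n in atTop, q n ≤ v) ∧
      (∀ n, ∀ᶠ k in atTop, q k ≤ q n) ∧
      (∀ᵐ ω ∂μ, Tendsto (fun n => W (q n) ω) atTop (𝓝 (Z u ω))) ∧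
      ∀ Y ∈ D, ∀ᵐ ω ∂μ, Tendsto (fun n => Y (q n) ω) atTop (𝓝 (Y u ω)) := by
    intro u hu
    rcases hu.2.lt_or_eq with h | h
    · obtain ⟨q, h1, h2, h3⟩ := hZq u ⟨hu.1, h⟩
      refine ⟨q, fun n => ⟨(h1 n).1.le, (h1 n).2.le⟩, h2,
        fun v _ huv => h2.eventually_le_const huv,
        fun n => h2.eventually_le_const (h1 n).1, h3, fun Y hY => ?_⟩
      filter_upwards [(hD Y hY).1.1.2.2] with ω hω
      exact (hω.1 u ⟨hu.1, h⟩).comp (tendsto_nhdsWithin_iff.2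
        ⟨h2, Eventually.of_forall fun n => (h1 n).1⟩)
    · refine ⟨fun _ => u, fun _ => ⟨le_rfl, hu.2⟩, tendsto_const_nhds,
        fun v _ huv => Eventually.of_forall fun _ => huv.le,
        fun _ => Eventually.of_forall fun _ => le_rfl, ?_, fun Y _ => ae_of_all _ fun _ =>
          tendsto_const_nhds⟩
      rw [h, hZT]
      exact ae_of_all _ fun _ => tendsto_const_nhds
  have hYWm : ∀ Y ∈ D, ∀ u ∈ Icc 0 T, Measurable[ℱ u] fun ω => ENNReal.ofReal (Y u ω * W u ω) :=
    fun Y hY u hu => (((hD Y hY).1.1.measurable hu).mul (hWm u hu.1)).ennreal_ofReal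
  have hYZm : ∀ Y ∈ D, ∀ u ∈ Icc 0 T, Measurable fun ω => ENNReal.ofReal (Y u ω * Z u ω) :=
    fun Y hY u hu => (((hD Y hY).1.1.mul hZ).measurable' hu).ennreal_ofReal
  have hlim : ∀ Y ∈ D, ∀ (u : ℝ) (q : ℕ → ℝ),
      (∀ᵐ ω ∂μ, Tendsto (fun n => W (q n) ω) atTop (𝓝 (Z u ω))) →
      (∀ᵐ ω ∂μ, Tendsto (fun n => Y (q n) ω) atTop (𝓝 (Y u ω))) →
      ∀ᵐ ω ∂μ, Tendsto (fun n => ENNReal.ofReal (Y (q n) ω * W (q n) ω)) atTop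
        (𝓝 (ENNReal.ofReal (Y u ω * Z u ω))) := by
    intro Y _ u q h1 h2
    filter_upwards [h1, h2] with ω h1 h2
    exact ENNReal.tendsto_ofReal (h2.mul h1)
  refine ⟨Z, ⟨hZ, fun X hX => ?_⟩, hZ0, ?_, fun u hu => ?_⟩
  · have h0 : ∀ᵐ ω ∂μ, X 0 ω * Z 0 ω ≤ 1 := by
      filter_upwards [(hD X hX).2, (hD X hX).1.1.nonneg ⟨le_rfl, hT.le⟩] with ω h1 h2
      exact mul_le_one₀ h1 (hZ0 0 ω) (hZ1 0 ω)
    refine ⟨superMG_of_condLE ((hD X hX).1.1.mul hZ) (lintegral_ofReal_ne_top_of_le_one h0) ?_, h0⟩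
    intro u v hu hv huv
    rcases huv.eq_or_lt with rfl | huv
    · exact fun _ _ => le_rfl
    obtain ⟨q, q1, q2, q3, q4, q5, q6⟩ := hseq u hu
    obtain ⟨r, r1, r2, r3, r4, r5, r6⟩ := hseq v hv
    have hq : ∀ n, q n ∈ Icc 0 T := fun n => ⟨hu.1.trans (q1 n).1, (q1 n).2⟩
    have hr : ∀ n, r n ∈ Icc 0 T := fun n => ⟨hv.1.trans (r1 n).1, (r1 n).2⟩
    refine condLE_of_rightLimit (M := fun n => ℱ (q n)) (fun n => ℱ.mono (q1 n).1)
      (fun n => ℱ.le _) (fun n => hYWm X hX _ (hq n)) (hYZm X hX u hu)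
      (fun n => (hYWm X hX _ (hr n)).mono (ℱ.le _) le_rfl) (hYZm X hX v hv)
      (hlim X hX u q q5 (q6 X hX)) (hlim X hX v r r5 (r6 X hX)) ?_
    filter_upwards [q3 v hv huv] with n hn
    exact Eventually.of_forall fun k => hYW X hX _ (hq n) _ (hr k) (hn.trans (r1 k).1)
  · obtain ⟨q, q1, -, -, -, q5, -⟩ := hseq t ht
    filter_upwards [q5] with ω h
    have e : (fun n => W (q n) ω) = fun _ => g ω := funext fun n => by rw [hWt _ (q1 n).1]
    rw [e] at h
    exact tendsto_nhds_unique h tendsto_const_nhds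
  · obtain ⟨Yn, h1, h2, h3⟩ := hWn u hu
    refine ⟨Yn, h1, h2, fun φ hφ => le_trans ?_ (h3 φ hφ)⟩
    have hu' : u ∈ Icc 0 T := ⟨hu.1, hu.2.le.trans ht.2⟩
    obtain ⟨q, q1, -, -, -, q5, q6⟩ := hseq u hu'
    have hq : ∀ n, q n ∈ Icc 0 T := fun n => ⟨hu.1.trans (q1 n).1, (q1 n).2⟩
    exact condLE_of_tendsto_left (ℱ.le u) ((hYWm Ys hYs u hu').mono (ℱ.le _) le_rfl)
      (fun n => (hYWm Ys hYs _ (hq n)).mono (ℱ.le _) le_rfl) (hYZm Ys hYs u hu')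
      (hlim Ys hYs u q q5 (q6 Ys hYs))
      (Eventually.of_forall fun n => hYW Ys hYs u hu' _ (hq n) (q1 n).1) φ hφ

/-- Every linear bound on the relative increments of elements of `D` is inherited by the process
bipolar. -/
lemma lintegral_ratio_le_of_mem_bipolar [IsProbabilityMeasure μ] (hT : 0 < T)
    (hrc : ∀ t : ℝ, (ℱ t : MeasurableSpace Ω) = ⨅ (s : ℝ) (_ : t < s), ℱ s)
    (hD : ∀ X ∈ D, S1mem μ T ℱ X)
    (hF : ForkConvex μ T ℱ D) (hYs : Ys ∈ D) (hpos : ∀ᵐ ω ∂μ, 0 < Ys T ω)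
    (hX : X ∈ procPolar μ T ℱ (procPolar μ T ℱ D)) {s t : ℝ}
    (hs : 0 ≤ s) (hst : s < t) (ht : t ≤ T) {g : Ω → ℝ} (hg : Measurable[ℱ t] g)
    (hg0 : ∀ ω, 0 ≤ g ω) (hg1 : ∀ ω, g ω ≤ 1) {c : ℝ≥0∞}
    (hc : ∀ Y ∈ D, ∫⁻ ω, ENNReal.ofReal (Y t ω / Y s ω * g ω) ∂μ ≤ c) :
    ∫⁻ ω, ENNReal.ofReal (X t ω / X s ω * g ω) ∂μ ≤ c := by
  have hsI : s ∈ Icc 0 T := ⟨hs, hst.le.trans ht⟩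
  have htI : t ∈ Icc 0 T := ⟨hs.trans hst.le, ht⟩
  obtain ⟨Z, hZ, hZ0, hZt, hZn⟩ := exists_dual_proc hT hrc hD hF hYs hpos htI hg hg0 hg1
  obtain ⟨Yn, h1, h2, h3⟩ := hZn s ⟨hs, hst⟩
  have hYs1 := (hD Ys hYs).1
  calc ∫⁻ ω, ENNReal.ofReal (X t ω / X s ω * g ω) ∂μ
      ≤ ∫⁻ ω, ENNReal.ofReal (1 / X s ω) * ENNReal.ofReal (Z t ω * X t ω) ∂μ := by
        refine lintegral_mono_ae ?_
        filter_upwards [hZt, hX.1.nonneg hsI] with ω k1 k2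
        rw [← ENNReal.ofReal_mul (by positivity), k1]
        refine ENNReal.ofReal_le_ofReal (le_of_eq ?_)
        ring
    _ ≤ ∫⁻ ω, ENNReal.ofReal (1 / X s ω) * ENNReal.ofReal (Z s ω * X s ω) ∂μ :=
        (hX.2 Z hZ).1.condLE hsI htI hst.le _
          (measurable_const.div (hX.1.measurable hsI)).ennreal_ofReal
    _ ≤ ∫⁻ ω, ENNReal.ofReal (1 / Ys s ω) * ENNReal.ofReal (Ys s ω * Z s ω) ∂μ := by
        refine lintegral_mono_ae ?_
        filter_upwards [hX.1.nonneg hsI, hYs1.pos hpos hsI] with ω k1 k2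
        rw [← ENNReal.ofReal_mul (by positivity), ← ENNReal.ofReal_mul (by positivity)]
        refine ENNReal.ofReal_le_ofReal ?_
        have e : 1 / Ys s ω * (Ys s ω * Z s ω) = Z s ω := by field_simp
        have e' : 1 / X s ω * (Z s ω * X s ω) = Z s ω * (X s ω / X s ω) := by ring
        rw [e, e']
        exact mul_le_of_le_one_right (hZ0 s ω) (div_self_le_one _)
    _ ≤ ⨆ n, ∫⁻ ω, ENNReal.ofReal (1 / Ys s ω) * ENNReal.ofReal (Yn n t ω * g ω) ∂μ :=
        h3 _ (measurable_const.div (hYs1.1.measurable hsI)).ennreal_ofReal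
    _ ≤ c := by
        refine iSup_le fun n => le_trans (lintegral_mono_ae ?_) (hc _ (h1 n))
        have hn := (hD _ (h1 n)).1
        filter_upwards [h2 n, hn.1.nonneg hsI, hn.1.nonneg htI, hn.eq_zero hsI htI hst.le,
          hYs1.pos hpos hsI] with ω k1 k2 k3 k4 k5
        rw [← ENNReal.ofReal_mul (by positivity), ← mul_assoc]
        refine ENNReal.ofReal_le_ofReal (mul_le_mul_of_nonneg_right ?_ (hg0 ω))
        rw [one_div, inv_mul_le_iff₀ k5]
        exact le_mul_div_of_le k3 k2 k1 k4

end DualProc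

section BipolarLemma

variable {m0 : MeasurableSpace Ω} {μ : Measure Ω} {K : Set (Ω → ℝ)} {x : Ω → ℝ}

lemma exists_seq_tendsto_of_forall_lintegral_le_of_le_one [IsProbabilityMeasure μ]
    (hKm : ∀ f ∈ K, Measurable f) (hK0 : ∀ f ∈ K, ∀ ω, 0 ≤ f ω)
    (hconv : ∀ f ∈ K, ∀ g ∈ K, ∀ a b : ℝ, 0 ≤ a → 0 ≤ b → a + b = 1 →
      (fun ω => a * f ω + b * g ω) ∈ K)
    (hsolid : ∀ f ∈ K, ∀ g, Measurable g → (∀ ω, 0 ≤ g ω) → (∀ ω, g ω ≤ f ω) → g ∈ K)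
    (h0 : (fun _ => 0) ∈ K) (hx : Measurable x) (hx0 : ∀ ω, 0 ≤ x ω) (hx1 : ∀ ω, x ω ≤ 1)
    (hpolar : ∀ g : Ω → ℝ, Measurable g → (∀ ω, 0 ≤ g ω) → (∀ ω, g ω ≤ 1) → ∀ c : ℝ≥0∞,
      (∀ f ∈ K, ∫⁻ ω, ENNReal.ofReal (f ω * g ω) ∂μ ≤ c) →
        ∫⁻ ω, ENNReal.ofReal (x ω * g ω) ∂μ ≤ c) :
    ∃ f : ℕ → Ω → ℝ, (∀ n, f n ∈ K) ∧ (∀ n ω, f n ω ≤ x ω) ∧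
      ∀ᵐ ω ∂μ, Tendsto (fun n => f n ω) atTop (𝓝 (x ω)) := by
  have hbd : ∀ (f : Ω → ℝ) (C : ℝ), Measurable f → (∀ ω, 0 ≤ f ω) → (∀ ω, f ω ≤ C) →
      MemLp f 2 μ := fun f C hf hf0 hfC =>
    MemLp.of_bound hf.aestronglyMeasurable C (ae_of_all _ fun ω => by
      rw [Real.norm_of_nonneg (hf0 ω)]; exact hfC ω)
  have hmul : ∀ {f g : Ω → ℝ}, MemLp f 2 μ → MemLp g 2 μ → Integrable (fun ω => f ω * g ω) μ :=
    fun hf hg => hf.integrable_mul hg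
  let S : Set (Lp ℝ 2 μ) := {F | ∃ f ∈ K, F =ᵐ[μ] f}
  have hSne : S.Nonempty := ⟨0, _, h0, Lp.coeFn_zero _ _ _⟩
  have hSc : Convex ℝ S := by
    rintro F ⟨f, hf, hFf⟩ G ⟨g, hg, hGg⟩ a b ha hb hab
    refine ⟨_, hconv f hf g hg a b ha hb hab, ?_⟩
    filter_upwards [Lp.coeFn_add (a • F) (b • G), Lp.coeFn_smul a F, Lp.coeFn_smul b G, hFf, hGg]
      with ω h1 h2 h3 h4 h5
    rw [h1, Pi.add_apply, h2, h3, Pi.smul_apply, Pi.smul_apply, h4, h5, smul_eq_mul, smul_eq_mul]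
  have hX := hbd x 1 hx hx0 hx1
  obtain ⟨v, hv, hvmin⟩ := exists_norm_eq_iInf_of_complete_convex hSne.closure
    isClosed_closure.isComplete hSc.closure (hX.toLp x)
  have hinner := (norm_eq_iInf_iff_real_inner_le_zero hSc.closure hv).1 hvmin
  obtain ⟨Fn, hFn, hFnlim⟩ := mem_closure_iff_seq_limit.1 hv
  choose fn hfn hFfn using hFn
  obtain ⟨ns, -, hns⟩ := (tendstoInMeasure_of_tendsto_Lp hFnlim).exists_seq_tendsto_ae
  have hlim : ∀ᵐ ω ∂μ, Tendsto (fun n => fn (ns n) ω) atTop (𝓝 (v ω)) := by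
    filter_upwards [hns, ae_all_iff.2 hFfn] with ω h1 h2
    simpa only [h2] using h1
  have hv0 : ∀ᵐ ω ∂μ, 0 ≤ v ω := by
    filter_upwards [hlim] with ω h using ge_of_tendsto' h fun n => hK0 _ (hfn _) ω
  have hvm : Measurable v := (Lp.stronglyMeasurable v).measurable
  have hvL : MemLp v 2 μ := Lp.memLp v
  set φ : Ω → ℝ := fun ω => max (v ω) 0 with hφ
  have hφm : Measurable φ := hvm.max measurable_const
  have hφv : φ =ᵐ[μ] v := by
    filter_upwards [hv0] with ω h using max_eq_left h
  have hφL : MemLp φ 2 μ := hvL.ae_eq hφv.symm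
  set G : Ω → ℝ := fun ω => max (x ω - φ ω) 0 with hG
  have hGm : Measurable G := (hx.sub hφm).max measurable_const
  have hG0 : ∀ ω, 0 ≤ G ω := fun ω => le_max_right _ _
  have hG1 : ∀ ω, G ω ≤ 1 := fun ω => max_le (by
    have : 0 ≤ φ ω := le_max_right _ _
    linarith [hx1 ω]) zero_le_one
  have hGL := hbd G 1 hGm hG0 hG1
  have hxφL : MemLp (fun ω => x ω - φ ω) 2 μ := hX.sub hφL
  set c := ∫ ω, (x ω - φ ω) * φ ω ∂μ with hc
  have hKc : ∀ f ∈ K, MemLp f 2 μ → ∫ ω, (x ω - φ ω) * f ω ∂μ ≤ c := by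
    intro f hf hfL
    have h1 := hinner (hfL.toLp f) (subset_closure ⟨f, hf, hfL.coeFn_toLp⟩)
    rw [L2.inner_def] at h1
    have h2 : ∫ ω, ((x ω - φ ω) * f ω - (x ω - φ ω) * φ ω) ∂μ ≤ 0 := by
      refine le_trans (le_of_eq (integral_congr_ae ?_)) h1
      filter_upwards [Lp.coeFn_sub (hX.toLp x) v, Lp.coeFn_sub (hfL.toLp f) v, hX.coeFn_toLp,
        hfL.coeFn_toLp, hφv] with ω h1 h2 h3 h4 h5
      rw [h1, h2, Pi.sub_apply, Pi.sub_apply, h3, h4, h5]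
      simp only [RCLike.inner_apply, conj_trivial]
      ring
    rw [integral_sub (hmul hxφL hfL) (hmul hxφL hφL)] at h2
    linarith
  have hc0 : 0 ≤ c := by simpa using hKc _ h0 (MemLp.zero' (p := 2) (μ := μ))
  have hKG : ∀ f ∈ K, ∫⁻ ω, ENNReal.ofReal (f ω * G ω) ∂μ ≤ ENNReal.ofReal c := by
    intro f hf
    have hmin : ∀ n : ℕ, Measurable fun ω => min (f ω) n := fun n =>
      (hKm f hf).min measurable_const
    refine le_of_tendsto' (lintegral_tendsto_of_tendsto_of_monotone
      (f := fun (n : ℕ) ω => ENNReal.ofReal (min (f ω) n * G ω))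
      (fun n => ((hmin n).mul hGm).ennreal_ofReal.aemeasurable) ?_ ?_) fun n => ?_
    · refine ae_of_all _ fun ω n k hnk => ENNReal.ofReal_le_ofReal ?_
      have : (n : ℝ) ≤ k := by exact_mod_cast hnk
      have := hG0 ω
      gcongr
    · refine ae_of_all _ fun ω => tendsto_const_nhds.congr' ?_
      obtain ⟨N, hN⟩ := exists_nat_ge (f ω)
      filter_upwards [eventually_ge_atTop N] with n hn
      have : (N : ℝ) ≤ n := by exact_mod_cast hn
      rw [min_eq_left (hN.trans this)]
    · have hmin0 : ∀ ω, 0 ≤ min (f ω) n := fun ω => le_min (hK0 f hf ω) n.cast_nonneg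
      have hnL := hbd _ n (hmin n) hmin0 fun ω => min_le_right _ _
      rw [← ofReal_integral_eq_lintegral_ofReal (hmul hnL hGL)
        (ae_of_all _ fun ω => mul_nonneg (hmin0 ω) (hG0 ω))]
      refine ENNReal.ofReal_le_ofReal ?_
      have hA : MeasurableSet {ω | 0 < x ω - φ ω} := measurableSet_lt measurable_const
        (hx.sub hφm)
      set F := {ω | 0 < x ω - φ ω}.indicator fun ω => min (f ω) (n : ℝ) with hF
      have hFm : Measurable F := (hmin n).indicator hA
      have hF0 : ∀ ω, 0 ≤ F ω := fun ω => indicator_nonneg (fun ω _ => hmin0 ω) ω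
      have hFle : ∀ ω, F ω ≤ min (f ω) n := fun ω =>
        indicator_le_self' (fun ω _ => hmin0 ω) ω
      refine le_trans (le_of_eq (integral_congr_ae (ae_of_all _ fun ω => ?_)))
        (hKc F (hsolid f hf F hFm hF0 fun ω => (hFle ω).trans (min_le_left _ _))
          (hbd F n hFm hF0 fun ω => (hFle ω).trans (min_le_right _ _)))
      by_cases h : 0 < x ω - φ ω
      · have e : F ω = min (f ω) n := indicator_of_mem (s := {ω | 0 < x ω - φ ω}) h _
        simp only [e, hG, max_eq_left h.le, mul_comm]
      · have e : F ω = 0 := indicator_of_notMem (s := {ω | 0 < x ω - φ ω}) h _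
        simp [e, hG, max_eq_right (not_lt.1 h)]
  have hxG := hpolar G hGm hG0 hG1 _ hKG
  rw [← ofReal_integral_eq_lintegral_ofReal (hmul hX hGL)
    (ae_of_all _ fun ω => mul_nonneg (hx0 ω) (hG0 ω)), ENNReal.ofReal_le_ofReal_iff hc0] at hxG
  have hcG : c ≤ ∫ ω, φ ω * G ω ∂μ := by
    refine integral_mono (hmul hxφL hφL) (hmul hφL hGL) fun ω => ?_
    rw [mul_comm]
    exact mul_le_mul_of_nonneg_left (le_max_left _ _) (le_max_right _ _)
  have hGG : ∫ ω, G ω * G ω ∂μ ≤ 0 := by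
    have e : ∀ ω, G ω * G ω = x ω * G ω - φ ω * G ω := fun ω => by
      rcases le_total (x ω - φ ω) 0 with h | h
      · simp [hG, max_eq_right h]
      · simp only [hG, max_eq_left h]; ring
    simp only [e]
    rw [integral_sub (hmul hX hGL) (hmul hφL hGL)]
    linarith
  have hG00 := (integral_eq_zero_iff_of_nonneg (fun ω => mul_nonneg (hG0 ω) (hG0 ω))
    (hmul hGL hGL)).1 (le_antisymm hGG (integral_nonneg fun ω =>
      mul_nonneg (hG0 ω) (hG0 ω)))
  refine ⟨fun n ω => min (fn (ns n) ω) (x ω), fun n => hsolid _ (hfn (ns n)) _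
    ((hKm _ (hfn _)).min hx) (fun ω => le_min (hK0 _ (hfn _) ω) (hx0 ω))
    fun ω => min_le_left _ _, fun n ω => min_le_right _ _, ?_⟩
  filter_upwards [hlim, hG00, hφv] with ω h1 h2 h3
  have h4 : G ω = 0 := mul_self_eq_zero.1 h2
  have h5 : x ω ≤ v ω := by
    rw [← h3]
    have : x ω - φ ω ≤ G ω := le_max_left _ _
    linarith
  simpa [min_eq_right h5] using h1.min (tendsto_const_nhds (x := x ω))

lemma exists_seq_tendsto_of_forall_lintegral_le [IsProbabilityMeasure μ]
    (hKm : ∀ f ∈ K, Measurable f) (hK0 : ∀ f ∈ K, ∀ ω, 0 ≤ f ω)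
    (hconv : ∀ f ∈ K, ∀ g ∈ K, ∀ a b : ℝ, 0 ≤ a → 0 ≤ b → a + b = 1 →
      (fun ω => a * f ω + b * g ω) ∈ K)
    (hsolid : ∀ f ∈ K, ∀ g, Measurable g → (∀ ω, 0 ≤ g ω) → (∀ ω, g ω ≤ f ω) → g ∈ K)
    (h0 : (fun _ => 0) ∈ K) (hx : Measurable x) (hx0 : ∀ ω, 0 ≤ x ω)
    (hpolar : ∀ g : Ω → ℝ, Measurable g → (∀ ω, 0 ≤ g ω) → (∀ ω, g ω ≤ 1) → ∀ c : ℝ≥0∞,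
      (∀ f ∈ K, ∫⁻ ω, ENNReal.ofReal (f ω * g ω) ∂μ ≤ c) →
        ∫⁻ ω, ENNReal.ofReal (x ω * g ω) ∂μ ≤ c) :
    ∃ f : ℕ → Ω → ℝ, (∀ n, f n ∈ K) ∧ (∀ n ω, f n ω ≤ x ω) ∧
      ∀ᵐ ω ∂μ, Tendsto (fun n => f n ω) atTop (𝓝 (x ω)) := by
  have hw : ∀ ω, 0 < 1 + x ω := fun ω => by linarith [hx0 ω]
  have hwm : Measurable fun ω => 1 + x ω := measurable_const.add hx
  have hinv : ∀ (f : Ω → ℝ), (fun ω => (f ω * (1 + x ω)) / (1 + x ω)) = f := fun f =>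
    funext fun ω => mul_div_cancel_right₀ _ (hw ω).ne'
  obtain ⟨f, hf, hfx, hflim⟩ := exists_seq_tendsto_of_forall_lintegral_le_of_le_one (μ := μ)
    (K := {f | (fun ω => f ω * (1 + x ω)) ∈ K}) (x := fun ω => x ω / (1 + x ω))
    (fun f hf => by
      have := (hKm _ hf).div hwm
      exact hinv f ▸ this)
    (fun f hf ω => nonneg_of_mul_nonneg_left (hK0 _ hf ω) (hw ω))
    (fun f hf g hg a b ha hb hab => by
      have := hconv _ hf _ hg a b ha hb hab
      refine (congrArg (· ∈ K) (funext fun ω => ?_)).mpr this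
      ring)
    (fun f hf g hg hg0 hgf => hsolid _ hf _ (hg.mul hwm)
      (fun ω => mul_nonneg (hg0 ω) (hw ω).le)
      fun ω => mul_le_mul_of_nonneg_right (hgf ω) (hw ω).le)
    (by simpa using h0) (hx.div hwm) (fun ω => div_nonneg (hx0 ω) (hw ω).le)
    (fun ω => (div_le_one (hw ω)).2 (by linarith))
    (fun g hg hg0 hg1 c hc => by
      have := hpolar (fun ω => g ω / (1 + x ω)) (hg.div hwm) (fun ω => div_nonneg (hg0 ω) (hw ω).le)
        (fun ω => (div_le_one (hw ω)).2 (by linarith [hg1 ω, hx0 ω])) c fun f hf => by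
          have := hc (fun ω => f ω / (1 + x ω)) (by
            refine (congrArg (· ∈ K) (funext fun ω => ?_)).mpr hf
            exact div_mul_cancel₀ _ (hw ω).ne')
          simpa only [div_mul_eq_mul_div, mul_div_assoc'] using this
      simpa only [div_mul_eq_mul_div, mul_div_assoc'] using this)
  refine ⟨fun n ω => f n ω * (1 + x ω), hf, fun n ω => (le_div_iff₀ (hw ω)).1 (hfx n ω), ?_⟩
  filter_upwards [hflim] with ω h
  simpa [div_mul_cancel₀ _ (hw ω).ne'] using h.mul_const (1 + x ω)

end BipolarLemma

section RelativeIncrement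

variable {m0 : MeasurableSpace Ω} {μ : Measure Ω} {T : ℝ} {ℱ : Filtration ℝ m0}
  {D : Set (ℝ → Ω → ℝ)} {Y Y2 Ys X : ℝ → Ω → ℝ}

lemma vmem_ite (t : ℝ) {b : Ω → ℝ} (hb : Measurable[ℱ t] b) (hb0 : ∀ ω, 0 ≤ b ω)
    (hb1 : ∀ ω, b ω ≤ 1) : Vmem μ T ℱ (fun u ω => if u < t then 1 else b ω) := by
  have h1 : ∀ u ω, (if u < t then 1 else b ω) ≤ 1 := fun u ω => by split_ifs <;> simp [hb1]
  refine ⟨⟨fun u _ => ?_, ae_of_all _ fun ω u _ => ?_,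
    ae_of_all _ fun ω => (CadlagOn.const 1).ite t (CadlagOn.const (b ω))⟩,
    ae_of_all _ fun ω u _ v _ huv => ?_, ae_of_all _ fun ω => h1 0 ω⟩
  · rcases lt_or_ge u t with h | h
    · simpa only [if_pos h] using stronglyMeasurable_const
    · simpa only [if_neg h.not_gt] using (hb.mono (ℱ.mono h) le_rfl).stronglyMeasurable
  · show 0 ≤ if u < t then 1 else b ω
    split_ifs
    · exact zero_le_one
    · exact hb0 ω
  · rcases lt_or_ge u t with h | h
    · simpa only [if_pos h] using h1 v ω
    · simp only [if_neg h.not_gt, if_neg (h.trans huv).not_gt, le_rfl]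

lemma exists_mem_eq_mul [IsProbabilityMeasure μ] (hD : ∀ X ∈ D, S1mem μ T ℱ X)
    (hF : ForkConvex μ T ℱ D) (hS : ProcSolid μ T ℱ D) (hYs : Ys ∈ D)
    (hpos : ∀ᵐ ω ∂μ, 0 < Ys T ω) {s t : ℝ} (hs : 0 ≤ s) (hst : s < t) (ht : t ≤ T)
    {f : Ω → ℝ} (hf : Measurable[ℱ t] f) (hf0 : ∀ ω, 0 ≤ f ω) (hY2 : Y2 ∈ D)
    (hfY : f ≤ᵐ[μ] fun ω => Y2 t ω / Y2 s ω) (hY : Y ∈ D) :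
    ∃ Y' ∈ D, (∀ u ≤ s, Y' u =ᵐ[μ] Y u) ∧ Y' t =ᵐ[μ] fun ω => Y s ω * f ω := by
  have hsI : s ∈ Icc 0 T := ⟨hs, hst.le.trans ht⟩
  have htI : t ∈ Icc 0 T := ⟨hs.trans hst.le, ht⟩
  have hA : MeasurableSet[ℱ s] {ω | Y2 s ω ≠ 0} :=
    ((hD Y2 hY2).1.1.measurable hsI (measurableSet_singleton 0)).compl
  set h : Ω → ℝ := {ω | Y2 s ω ≠ 0}.indicator fun _ => 1 with hh
  have hh0 : ∀ ω, 0 ≤ h ω := fun ω => indicator_nonneg (fun _ _ => zero_le_one) ω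
  have hh1 : ∀ ω, h ω ≤ 1 := fun ω => indicator_le_self' (fun _ _ => zero_le_one) ω
  have hV : fork s h Y Y2 Ys ∈ D :=
    hF s hsI h (stronglyMeasurable_const.indicator hA) hh0 hh1 Y hY Y2 hY2 Ys hYs
  set V := fork s h Y Y2 Ys with hVdef
  set b : Ω → ℝ := fun ω => max 0 (min 1 (Y s ω * f ω / V t ω)) with hb
  have hYm : Measurable[ℱ t] (Y s) := ((hD Y hY).1.1.measurable hsI).mono (ℱ.mono hst.le) le_rfl
  have hVm : Measurable[ℱ t] (V t) := (hD V hV).1.1.measurable htI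
  have hbm : Measurable[ℱ t] b := measurable_const.max (measurable_const.min ((hYm.mul hf).div hVm))
  refine ⟨_, hS V hV _ (vmem_ite t hbm (fun ω => le_max_left _ _)
    fun ω => max_le zero_le_one (min_le_left _ _)), fun u hu => ?_, ?_⟩
  · simp only [if_pos (hu.trans_lt hst), mul_one]
    rcases hu.lt_or_eq with hu | rfl
    · rw [hVdef, fork_of_lt h hu]
    · filter_upwards [(hD Ys hYs).1.pos hpos hsI] with ω h1
      rw [hVdef, fork_of_le h le_rfl, div_self h1.ne']
      by_cases h2 : Y2 u ω = 0
      · simp [hh, h2]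
      · simp [hh, h2]
  · filter_upwards [hfY, (hD Y hY).1.1.nonneg hsI, (hD V hV).1.1.nonneg htI] with ω k1 k2 k3
    have hle : Y s ω * f ω ≤ V t ω := by
      by_cases h2 : Y2 s ω = 0
      · have e0 : f ω = 0 := le_antisymm (by simpa [h2] using k1) (hf0 ω)
        rwa [e0, mul_zero]
      · rw [hVdef, fork_of_le h hst.le]
        refine mul_le_mul_of_nonneg_left ?_ k2
        simpa [hh, h2] using k1
    have hn := mul_nonneg k2 (hf0 ω)
    rw [if_neg (lt_irrefl t), hb]
    simp only
    rcases k3.eq_or_lt with k | k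
    · rw [← k, zero_mul]
      exact le_antisymm hn (hle.trans k.symm.le)
    · rw [min_eq_right ((div_le_one k).2 hle), max_eq_right (div_nonneg hn k3),
        mul_div_cancel₀ _ k.ne']

lemma exists_seq_relative_increment [IsProbabilityMeasure μ] (hT : 0 < T)
    (hrc : ∀ t : ℝ, (ℱ t : MeasurableSpace Ω) = ⨅ (s : ℝ) (_ : t < s), ℱ s)
    (hD : ∀ X ∈ D, S1mem μ T ℱ X) (hF : ForkConvex μ T ℱ D) (hYs : Ys ∈ D)
    (hpos : ∀ᵐ ω ∂μ, 0 < Ys T ω)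
    (hX : X ∈ procPolar μ T ℱ (procPolar μ T ℱ D)) {s t : ℝ}
    (hs : 0 ≤ s) (hst : s < t) (ht : t ≤ T) :
    ∃ f : ℕ → Ω → ℝ, (∀ n, Measurable[ℱ t] (f n)) ∧ (∀ n ω, 0 ≤ f n ω) ∧
      (∀ n, ∃ Y ∈ D, f n ≤ᵐ[μ] fun ω => Y t ω / Y s ω) ∧
      (∀ n, f n ≤ᵐ[μ] fun ω => X t ω / X s ω) ∧
      ∀ᵐ ω ∂μ, Tendsto (fun n => f n ω) atTop (𝓝 (X t ω / X s ω)) := by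
  have hsI : s ∈ Icc 0 T := ⟨hs, hst.le.trans ht⟩
  have htI : t ∈ Icc 0 T := ⟨hs.trans hst.le, ht⟩
  have hrm : ∀ Y : ℝ → Ω → ℝ, PosProc μ T ℱ Y →
      Measurable[ℱ t] fun ω => max (Y t ω / Y s ω) 0 := fun Y hY =>
    ((hY.measurable htI).div ((hY.measurable hsI).mono (ℱ.mono hst.le) le_rfl)).max
      measurable_const
  have hr0 : ∀ Y : ℝ → Ω → ℝ, PosProc μ T ℱ Y →
      (fun ω => max (Y t ω / Y s ω) 0) =ᵐ[μ] fun ω => Y t ω / Y s ω := fun Y hY => by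
    filter_upwards [hY.nonneg hsI, hY.nonneg htI] with ω h1 h2
    exact max_eq_left (div_nonneg h2 h1)
  set K : Set (Ω → ℝ) := {f | Measurable[ℱ t] f ∧ (∀ ω, 0 ≤ f ω) ∧
    ∃ Y ∈ D, f ≤ᵐ[μ] fun ω => Y t ω / Y s ω} with hK
  have : IsProbabilityMeasure (μ.trim (ℱ.le t)) :=
    ⟨by rw [trim_measurableSet_eq (ℱ.le t) MeasurableSet.univ, measure_univ]⟩
  suffices H : ∃ f : ℕ → Ω → ℝ, (∀ n, f n ∈ K) ∧ (∀ n ω, f n ω ≤ max (X t ω / X s ω) 0) ∧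
      ∀ᵐ ω ∂(μ.trim (ℱ.le t)), Tendsto (fun n => f n ω) atTop (𝓝 (max (X t ω / X s ω) 0)) by
    obtain ⟨f, hf, hfx, hflim⟩ := H
    refine ⟨f, fun n => (hf n).1, fun n => (hf n).2.1, fun n => (hf n).2.2, fun n => ?_, ?_⟩
    · filter_upwards [hr0 X hX.1] with ω h
      exact (hfx n ω).trans h.le
    · filter_upwards [hr0 X hX.1, ae_of_ae_trim _ hflim] with ω h h'
      rwa [← h]
  refine @exists_seq_tendsto_of_forall_lintegral_le Ω (ℱ t)
    (μ.trim (ℱ.le t)) K (fun ω => max (X t ω / X s ω) 0) this (fun f hf => hf.1)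
    (fun f hf => hf.2.1) ?_ ?_ ?_ (hrm X hX.1) (fun ω => le_max_right _ _) ?_
  · rintro f ⟨hf, hf0, Y2, hY2, hfY⟩ g ⟨hg, hg0, Y3, hY3, hgY⟩ a b ha hb hab
    refine ⟨(measurable_const.mul hf).add (measurable_const.mul hg),
      fun ω => add_nonneg (mul_nonneg ha (hf0 ω)) (mul_nonneg hb (hg0 ω)), fork s (fun _ => a) Ys Y2 Y3,
      hF s hsI (fun _ => a) stronglyMeasurable_const (fun _ => ha) (fun _ => by linarith) Ys hYs
        Y2 hY2 Y3 hY3, ?_⟩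
    filter_upwards [hfY, hgY, (hD Ys hYs).1.pos hpos hsI, (hD Y2 hY2).1.1.nonneg hsI,
      (hD Y2 hY2).1.1.nonneg htI, (hD Y3 hY3).1.1.nonneg hsI,
      (hD Y3 hY3).1.1.nonneg htI] with ω k1 k2 k3 k4 k5 k6 k7
    rw [fork_of_le _ hst.le, fork_of_le _ le_rfl, mul_div_mul_left _ _ k3.ne',
      show 1 - a = b by linarith]
    have hN : a * f ω + b * g ω ≤ a * (Y2 t ω / Y2 s ω) + b * (Y3 t ω / Y3 s ω) := by gcongr
    refine hN.trans ?_
    have e2 := div_self_le_one (Y2 s ω)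
    have e3 := div_self_le_one (Y3 s ω)
    have q2 : 0 ≤ Y2 s ω / Y2 s ω := div_nonneg k4 k4
    have q3 : 0 ≤ Y3 s ω / Y3 s ω := div_nonneg k6 k6
    have hle : a * (Y2 s ω / Y2 s ω) + b * (Y3 s ω / Y3 s ω) ≤ 1 := by nlinarith
    have h0 : 0 ≤ a * (Y2 s ω / Y2 s ω) + b * (Y3 s ω / Y3 s ω) := by positivity
    rcases h0.eq_or_lt with h0 | h0
    · have z2 : a * (Y2 s ω / Y2 s ω) = 0 := by nlinarith [mul_nonneg ha q2, mul_nonneg hb q3]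
      have z3 : b * (Y3 s ω / Y3 s ω) = 0 := by nlinarith [mul_nonneg ha q2, mul_nonneg hb q3]
      have w2 : a * (Y2 t ω / Y2 s ω) = 0 := by
        rcases mul_eq_zero.1 z2 with h | h
        · simp [h]
        · simp [show Y2 s ω = 0 by by_contra h'; exact one_ne_zero ((div_self h').symm.trans h)]
      have w3 : b * (Y3 t ω / Y3 s ω) = 0 := by
        rcases mul_eq_zero.1 z3 with h | h
        · simp [h]
        · simp [show Y3 s ω = 0 by by_contra h'; exact one_ne_zero ((div_self h').symm.trans h)]
      simp [w2, w3]
    · exact le_div_self (by positivity) h0 hle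
  · rintro f ⟨hf, hf0, Y2, hY2, hfY⟩ g hg hg0 hgf
    exact ⟨hg, hg0, Y2, hY2, by filter_upwards [hfY] with ω h using (hgf ω).trans h⟩
  · refine ⟨measurable_const, fun _ => le_rfl, Ys, hYs, ?_⟩
    filter_upwards [(hD Ys hYs).1.1.nonneg hsI, (hD Ys hYs).1.1.nonneg htI] with ω h1 h2
    exact div_nonneg h2 h1
  · intro g hg hg0 hg1 c hc
    have htrim : ∀ Y : ℝ → Ω → ℝ, PosProc μ T ℱ Y →
        ∫⁻ ω, ENNReal.ofReal (max (Y t ω / Y s ω) 0 * g ω) ∂(μ.trim (ℱ.le t)) =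
          ∫⁻ ω, ENNReal.ofReal (Y t ω / Y s ω * g ω) ∂μ := fun Y hY => by
      rw [lintegral_trim (ℱ.le t)
        (f := fun ω => ENNReal.ofReal (max (Y t ω / Y s ω) 0 * g ω)) ((hrm Y hY).mul hg).ennreal_ofReal]
      refine lintegral_congr_ae ?_
      filter_upwards [hr0 Y hY] with ω h
      rw [h]
    rw [htrim X hX.1]
    refine lintegral_ratio_le_of_mem_bipolar hT hrc hD hF hYs hpos hX hs hst ht hg hg0 hg1
      fun Y hY => ?_
    rw [← htrim Y (hD Y hY).1.1]
    exact hc _ ⟨hrm Y (hD Y hY).1.1, fun ω => le_max_right _ _, Y, hY, (hr0 Y (hD Y hY).1.1).le⟩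

end RelativeIncrement

section Approximation

variable {m0 : MeasurableSpace Ω} {μ : Measure Ω} {T : ℝ} {ℱ : Filtration ℝ m0}
  {D : Set (ℝ → Ω → ℝ)} {Y Ys X : ℝ → Ω → ℝ}

lemma SuperMG.const_mul [IsFiniteMeasure μ] (h : SuperMG μ T ℱ X) {c : ℝ} (hc : 0 ≤ c) :
    SuperMG μ T ℱ fun t ω => X t ω * c := by
  have hP : PosProc μ T ℱ fun t ω => X t ω * c := h.1.mul (PosProc.const hc)
  refine ⟨hP, fun t ht => (h.2.1 t ht).mul_const c, fun s t hs ht hst => ?_⟩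
  refine CondLE.condExp_le ?_ (ℱ.le s) ((h.2.1 t ht).mul_const c) (hP.measurable' ht)
    (hP.nonneg ht) (hP.measurable hs) (hP.nonneg hs)
  simp only [ENNReal.ofReal_mul' hc, mul_comm _ (ENNReal.ofReal c)]
  exact (h.condLE hs ht hst).mul measurable_const

lemma ae_eq_const_of_trivial [IsProbabilityMeasure μ] {m : MeasurableSpace Ω} (hm : m ≤ m0)
    (htriv : ∀ A : Set Ω, MeasurableSet[m] A → μ A = 0 ∨ μ A = 1) {f : Ω → ℝ}
    (hf : Measurable[m] f) : ∃ c : ℝ, ∀ᵐ ω ∂μ, f ω = c := by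
  refine exists_eventuallyEq_const_of_forall_separating (l := ae μ) MeasurableSet fun U hU => ?_
  rcases htriv _ (hf hU) with h | h
  · exact Or.inr (measure_eq_zero_iff_ae_notMem.1 h)
  · exact Or.inl ((prob_compl_eq_zero_iff (hm _ (hf hU))).2 h)

lemma exists_mem_initial_value_ge [IsProbabilityMeasure μ] (hT : 0 < T)
    (htriv : ∀ A : Set Ω, MeasurableSet[ℱ 0] A → μ A = 0 ∨ μ A = 1)
    (hD : ∀ X ∈ D, S1mem μ T ℱ X) (hS : ProcSolid μ T ℱ D) (hne : D.Nonempty)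
    (hX : X ∈ procPolar μ T ℱ (procPolar μ T ℱ D)) {ε : ℝ} (hε : 0 < ε) :
    ∃ Y ∈ D, Y 0 ≤ᵐ[μ] X 0 ∧ ∀ᵐ ω ∂μ, X 0 ω - Y 0 ω ≤ ε := by
  have h0I : (0 : ℝ) ∈ Icc 0 T := ⟨le_rfl, hT.le⟩
  obtain ⟨x, hx⟩ := ae_eq_const_of_trivial (ℱ.le 0) htriv (hX.1.measurable h0I)
  have hx0 : 0 ≤ x := by
    obtain ⟨ω, h1, h2⟩ := (hx.and (hX.1.nonneg h0I)).exists
    rwa [← h1]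
  have hV : ∀ b : ℝ, 0 ≤ b → b ≤ 1 → Vmem μ T ℱ fun _ _ => b := fun b hb0 hb1 =>
    ⟨PosProc.const hb0, ae_of_all _ fun _ _ _ _ _ _ => le_rfl, ae_of_all _ fun _ => hb1⟩
  rcases le_or_gt x ε with hxε | hxε
  · obtain ⟨Y, hY⟩ := hne
    refine ⟨_, hS Y hY _ (hV 0 le_rfl zero_le_one), ?_, ?_⟩
    · filter_upwards [hx] with ω h
      simpa [h] using hx0
    · filter_upwards [hx] with ω h
      simpa [h] using hxε
  have hc : 0 < x - ε := sub_pos.2 hxε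
  suffices H : ∃ Y ∈ D, ∃ y, x - ε < y ∧ ∀ᵐ ω ∂μ, Y 0 ω = y by
    obtain ⟨Y, hY, y, hy, hYy⟩ := H
    have hy0 : 0 < y := hc.trans hy
    refine ⟨_, hS Y hY _ (hV ((x - ε) / y) (by positivity) ((div_le_one hy0).2 hy.le)), ?_, ?_⟩
    · filter_upwards [hx, hYy] with ω h1 h2
      rw [h1, h2, mul_div_cancel₀ _ hy0.ne']
      linarith
    · filter_upwards [hx, hYy] with ω h1 h2
      rw [h1, h2, mul_div_cancel₀ _ hy0.ne']
      linarith
  by_contra! H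
  have hmem : (fun _ _ => (x - ε)⁻¹ : ℝ → Ω → ℝ) ∈ procPolar μ T ℱ D := by
    refine ⟨PosProc.const (by positivity), fun Y hY =>
      ⟨(hD Y hY).1.const_mul (by positivity), ?_⟩⟩
    obtain ⟨y, hy⟩ := ae_eq_const_of_trivial (ℱ.le 0) htriv ((hD Y hY).1.1.measurable h0I)
    have hyx : y ≤ x - ε := by
      by_contra! h
      exact H Y hY y h (hy.mono fun ω hω => not_not.2 hω)
    filter_upwards [hy] with ω h
    rw [h, ← div_eq_mul_inv]
    exact (div_le_one hc).2 hyx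
  obtain ⟨ω, h1, h2⟩ := ((hX.2 _ hmem).2.and hx).exists
  rw [h2, inv_mul_le_iff₀ hc] at h1
  linarith

lemma exists_mem_extend [IsProbabilityMeasure μ] (hT : 0 < T)
    (hrc : ∀ t : ℝ, (ℱ t : MeasurableSpace Ω) = ⨅ (s : ℝ) (_ : t < s), ℱ s)
    (hD : ∀ X ∈ D, S1mem μ T ℱ X) (hF : ForkConvex μ T ℱ D) (hS : ProcSolid μ T ℱ D)
    (hYs : Ys ∈ D) (hpos : ∀ᵐ ω ∂μ, 0 < Ys T ω)
    (hX : X ∈ procPolar μ T ℱ (procPolar μ T ℱ D)) (hX' : SuperMG μ T ℱ X) {s t : ℝ}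
    (hs : 0 ≤ s) (hst : s < t) (ht : t ≤ T) (hY : Y ∈ D) (hYX : Y s ≤ᵐ[μ] X s)
    {ε : ℝ≥0∞} (hε : 0 < ε) :
    ∃ Y' ∈ D, (∀ u ≤ s, Y' u =ᵐ[μ] Y u) ∧ Y' t ≤ᵐ[μ] X t ∧
      ∫⁻ ω, ENNReal.ofReal (X t ω - Y' t ω) ∂μ ≤
        ∫⁻ ω, ENNReal.ofReal (X s ω - Y s ω) ∂μ + ε := by
  have hsI : s ∈ Icc 0 T := ⟨hs, hst.le.trans ht⟩
  have htI : t ∈ Icc 0 T := ⟨hs.trans hst.le, ht⟩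
  obtain ⟨f, hfm, hf0, hfD, hfX, hflim⟩ :=
    exists_seq_relative_increment hT hrc hD hF hYs hpos hX hs hst ht
  have hXs := hX.1.measurable' hsI
  have hXt := hX.1.measurable' htI
  have hYm := (hD Y hY).1.1.measurable' hsI
  have hratio : ∀ᵐ ω ∂μ, X s ω * (X t ω / X s ω) = X t ω := by
    filter_upwards [hX'.eq_zero hsI htI hst.le] with ω h
    by_cases h' : X s ω = 0
    · simp [h', h h']
    · exact mul_div_cancel₀ _ h'
  have hfirst : ∫⁻ ω, ENNReal.ofReal ((X s ω - Y s ω) * (X t ω / X s ω)) ∂μ ≤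
      ∫⁻ ω, ENNReal.ofReal (X s ω - Y s ω) ∂μ := by
    have hφ : Measurable[ℱ s] fun ω => ENNReal.ofReal ((X s ω - Y s ω) / X s ω) :=
      (((hX.1.measurable hsI).sub ((hD Y hY).1.1.measurable hsI)).div
        (hX.1.measurable hsI)).ennreal_ofReal
    have key := hX'.condLE hsI htI hst.le _ hφ
    refine le_trans (lintegral_mono_ae ?_) (key.trans (lintegral_mono_ae ?_))
    · filter_upwards [hX.1.nonneg htI] with ω h
      rw [← ENNReal.ofReal_mul' h, mul_div_assoc', div_mul_eq_mul_div]
    · filter_upwards [hX.1.nonneg hsI] with ω h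
      rw [← ENNReal.ofReal_mul' h]
      by_cases h' : X s ω = 0
      · simp [h']
      · rw [div_mul_cancel₀ _ h']
  have hsecond : Tendsto (fun n => ∫⁻ ω, ENNReal.ofReal (Y s ω * (X t ω / X s ω - f n ω)) ∂μ)
      atTop (𝓝 0) := by
    rw [← lintegral_zero (μ := μ) (α := Ω)]
    refine tendsto_lintegral_of_dominated_convergence (fun ω => ENNReal.ofReal (X t ω))
      (fun n => (hYm.mul ((hXt.div hXs).sub
        ((hfm n).mono (ℱ.le t) le_rfl))).ennreal_ofReal) (fun n => ?_) ?_ ?_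
    · filter_upwards [hratio, hYX, (hD Y hY).1.1.nonneg hsI, hX.1.nonneg hsI, hfX n]
        with ω h1 h2 h3 h4 h5
      refine ENNReal.ofReal_le_ofReal (le_trans ?_ h1.le)
      exact mul_le_mul h2 (by linarith [hf0 n ω]) (sub_nonneg.2 h5) h4
    · exact (hX'.2.1 t htI).lintegral_lt_top.ne
    · filter_upwards [hflim] with ω h
      have := (ENNReal.continuous_ofReal.tendsto _).comp
        ((tendsto_const_nhds (x := X t ω / X s ω)).sub h |>.const_mul (Y s ω))
      simpa [Function.comp_def] using this
  obtain ⟨n, hn⟩ := (hsecond.eventually_le_const hε).exists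
  obtain ⟨Y2, hY2, hfY⟩ := hfD n
  obtain ⟨Y', hY', hYu, hYt⟩ := exists_mem_eq_mul hD hF hS hYs hpos hs hst ht (hfm n) (hf0 n)
    hY2 hfY hY
  refine ⟨Y', hY', hYu, ?_, ?_⟩
  · filter_upwards [hYt, hratio, hYX, hfX n, (hD Y hY).1.1.nonneg hsI, hX.1.nonneg hsI]
      with ω h1 h2 h3 h4 h5 h6
    rw [h1, ← h2]
    exact mul_le_mul h3 h4 (hf0 n ω) h6
  · refine le_trans ?_ (add_le_add hfirst hn)
    rw [← lintegral_add_left (f := fun ω => ENNReal.ofReal ((X s ω - Y s ω) * (X t ω / X s ω)))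
      (((hXs.sub hYm).mul (hXt.div hXs)).ennreal_ofReal)]
    refine lintegral_mono_ae ?_
    filter_upwards [hYt, hratio] with ω h1 h2
    refine le_trans (ENNReal.ofReal_le_ofReal ?_) ENNReal.ofReal_add_le
    rw [h1, ← h2]
    have h3 : X s ω * (X t ω / X s ω) / X s ω = X t ω / X s ω := by rw [h2]
    rw [h3]
    exact le_of_eq (by ring)

lemma exists_mem_approx [IsProbabilityMeasure μ] (hT : 0 < T)
    (hrc : ∀ t : ℝ, (ℱ t : MeasurableSpace Ω) = ⨅ (s : ℝ) (_ : t < s), ℱ s)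
    (htriv : ∀ A : Set Ω, MeasurableSet[ℱ 0] A → μ A = 0 ∨ μ A = 1)
    (hD : ∀ X ∈ D, S1mem μ T ℱ X) (hF : ForkConvex μ T ℱ D) (hS : ProcSolid μ T ℱ D)
    (hYs : Ys ∈ D) (hpos : ∀ᵐ ω ∂μ, 0 < Ys T ω)
    (hX : X ∈ procPolar μ T ℱ (procPolar μ T ℱ D)) (hX' : SuperMG μ T ℱ X) {τ : ℕ → ℝ}
    (hτ0 : τ 0 = 0) (hτ : Monotone τ) (hτT : ∀ j, τ j ≤ T) (n : ℕ) {ε : ℝ≥0∞} (hε : 0 < ε) :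
    ∃ Y ∈ D, ∀ i ≤ n, Y (τ i) ≤ᵐ[μ] X (τ i) ∧
      ∫⁻ ω, ENNReal.ofReal (X (τ i) ω - Y (τ i) ω) ∂μ ≤ ε := by
  induction n generalizing ε with
  | zero =>
    obtain ⟨δ, hδ0, hδ⟩ := ENNReal.lt_iff_exists_nnreal_btwn.1 hε
    obtain ⟨Y, hY, h1, h2⟩ := exists_mem_initial_value_ge hT htriv hD hS ⟨Ys, hYs⟩ hX
      (ε := δ) (by exact_mod_cast hδ0)
    refine ⟨Y, hY, fun i hi => ?_⟩
    rw [Nat.le_zero.1 hi, hτ0]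
    refine ⟨h1, le_trans (lintegral_mono_ae (g := fun _ => ENNReal.ofReal δ) ?_) ?_⟩
    · filter_upwards [h2] with ω h using ENNReal.ofReal_le_ofReal h
    · simpa using hδ.le
  | succ n ih =>
    have hε2 : 0 < ε / 2 := ENNReal.half_pos hε.ne'
    obtain ⟨Y, hY, h⟩ := ih hε2
    rcases (hτ n.le_succ).lt_or_eq with hlt | heq
    · have hn0 : 0 ≤ τ n := hτ0 ▸ hτ n.zero_le
      obtain ⟨Y', hY', h1, h2, h3⟩ := exists_mem_extend hT hrc hD hF hS hYs hpos hX hX' hn0 hlt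
        (hτT _) hY (h n le_rfl).1 hε2
      refine ⟨Y', hY', fun i hi => ?_⟩
      rcases hi.lt_or_eq with hi | rfl
      · have hi' := Nat.lt_succ_iff.1 hi
        have e := h1 (τ i) (hτ hi')
        refine ⟨e.le.trans (h i hi').1, ?_⟩
        rw [lintegral_congr_ae (g := fun ω => ENNReal.ofReal (X (τ i) ω - Y (τ i) ω))
          (by filter_upwards [e] with ω e; rw [e])]
        exact (h i hi').2.trans ENNReal.half_le_self
      · refine ⟨h2, h3.trans ?_⟩
        conv_rhs => rw [← ENNReal.add_halves ε]
        gcongr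
        exact (h n le_rfl).2
    · refine ⟨Y, hY, fun i hi => ?_⟩
      rcases hi.lt_or_eq with hi | rfl
      · exact ⟨(h i (Nat.lt_succ_iff.1 hi)).1, (h i (Nat.lt_succ_iff.1 hi)).2.trans ENNReal.half_le_self⟩
      · rw [← heq]
        exact ⟨(h n le_rfl).1, (h n le_rfl).2.trans ENNReal.half_le_self⟩

end Approximation

section Minimality

variable {m0 : MeasurableSpace Ω} {μ : Measure Ω} {T : ℝ} {ℱ : Filtration ℝ m0}
  {D : Set (ℝ → Ω → ℝ)} {Ys X : ℝ → Ω → ℝ}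

lemma ae_tendsto_of_lintegral_sub_le {f : ℕ → Ω → ℝ} {x : Ω → ℝ} (hf : ∀ n, Measurable (f n))
    (hx : Measurable x) {n₀ : ℕ} (hle : ∀ n ≥ n₀, f n ≤ᵐ[μ] x)
    (h : ∀ n ≥ n₀, ∫⁻ ω, ENNReal.ofReal (x ω - f n ω) ∂μ ≤ 2⁻¹ ^ n) :
    ∀ᵐ ω ∂μ, Tendsto (fun n => f n ω) atTop (𝓝 (x ω)) := by
  have hm : ∀ n, Measurable fun ω => ENNReal.ofReal (x ω - f (n + n₀) ω) :=
    fun n => (hx.sub (hf _)).ennreal_ofReal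
  have hsum : ∫⁻ ω, ∑' n, ENNReal.ofReal (x ω - f (n + n₀) ω) ∂μ ≠ ∞ := by
    rw [lintegral_tsum fun n => (hm n).aemeasurable]
    refine ne_top_of_le_ne_top ?_ (ENNReal.tsum_le_tsum (g := fun n => 2⁻¹ ^ n) fun n =>
      (h (n + n₀) (Nat.le_add_left _ _)).trans ?_)
    · rw [ENNReal.tsum_geometric]
      simp
    · exact pow_le_pow_right_of_le_one' (by simp) (Nat.le_add_right _ _)
  have hle' : ∀ᵐ ω ∂μ, ∀ n, f (n + n₀) ω ≤ x ω :=
    ae_all_iff.2 fun n => hle _ (Nat.le_add_left _ _)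
  filter_upwards [ae_lt_top (Measurable.tsum hm) hsum, hle'] with ω h1 h2
  have h3 := ENNReal.tendsto_atTop_zero_of_tsum_ne_top h1.ne
  rw [← tendsto_add_atTop_iff_nat n₀]
  have h4 := (ENNReal.tendsto_toReal ENNReal.zero_ne_top).comp h3
  have h5 : Tendsto (fun n => x ω - f (n + n₀) ω) atTop (𝓝 0) := by
    refine h4.congr fun n => ?_
    rw [Function.comp_apply, ENNReal.toReal_ofReal (sub_nonneg.2 (h2 n))]
  simpa using (tendsto_const_nhds (x := x ω)).sub h5

lemma fatouConv_of_tendsto (hT : 0 < T) (hX : PosProc μ T ℱ X) {Y : ℕ → ℝ → Ω → ℝ}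
    (h : ∀ q ∈ (dyadics ∩ Iio T) ∪ {T}, ∀ᵐ ω ∂μ, Tendsto (fun n => Y n q ω) atTop (𝓝 (X q ω))) :
    FatouConv μ T Y X := by
  have hcount : ((dyadics ∩ Iio T) ∪ {T}).Countable := by
    refine Countable.union (Countable.mono inter_subset_left ?_) (countable_singleton T)
    refine (countable_range fun p : ℕ × ℕ => (p.2 : ℝ) / 2 ^ p.1).mono ?_
    rintro x ⟨n, j, rfl⟩
    exact ⟨(n, j), rfl⟩
  have hfreq : ∀ t ∈ Ico 0 T, t ∈ closure (Ioi t ∩ ((dyadics ∩ Iio T) ∪ {T})) := by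
    intro t ht
    rw [Metric.mem_closure_iff]
    intro δ hδ
    obtain ⟨q, hq, h1, h2⟩ := exists_dyadic_btwn ht.1 (lt_min ht.2 (lt_add_of_pos_right t hδ))
    refine ⟨q, ⟨h1, Or.inl ⟨hq, h2.trans_le (min_le_left _ _)⟩⟩, ?_⟩
    have := h2.trans_le (min_le_right _ _)
    rw [Real.dist_eq, abs_sub_lt_iff]
    constructor <;> linarith
  refine ⟨(dyadics ∩ Iio T) ∪ {T}, hcount, ?_, fun t ht => ?_, ?_⟩
  · rintro q (⟨⟨n, j, rfl⟩, hq⟩ | rfl)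
    · exact ⟨by positivity, hq.le⟩
    · exact ⟨hT.le, le_rfl⟩
  · rcases ht.2.lt_or_eq with h | rfl
    · exact closure_mono inter_subset_right (hfreq t ⟨ht.1, h⟩)
    · exact subset_closure (Or.inr rfl)
  filter_upwards [(ae_ball_iff hcount).2 h, hX.2.2] with ω hω hcad
  refine ⟨fun t ht => ?_, hω T (Or.inr rfl)⟩
  have : (𝓝[Ioi t ∩ ((dyadics ∩ Iio T) ∪ {T})] t).NeBot :=
    mem_closure_iff_nhdsWithin_neBot.1 (hfreq t ht)
  have hlim : Tendsto (fun s => ENNReal.ofReal (X s ω))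
      (𝓝[Ioi t ∩ ((dyadics ∩ Iio T) ∪ {T})] t) (𝓝 (ENNReal.ofReal (X t ω))) :=
    (ENNReal.continuous_ofReal.tendsto _).comp
      ((hcad.1 t ht).mono_left (nhdsWithin_mono _ inter_subset_left))
  have hq : ∀ q ∈ Ioi t ∩ ((dyadics ∩ Iio T) ∪ {T}),
      Tendsto (fun n => ENNReal.ofReal (Y n q ω)) atTop (𝓝 (ENNReal.ofReal (X q ω))) :=
    fun q hq => (ENNReal.continuous_ofReal.tendsto _).comp (hω q hq.2)
  constructor
  · refine (Tendsto.liminf_eq (hlim.congr' ?_)).symm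
    filter_upwards [self_mem_nhdsWithin] with q h using (hq q h).liminf_eq.symm
  · refine (Tendsto.limsup_eq (hlim.congr' ?_)).symm
    filter_upwards [self_mem_nhdsWithin] with q h using (hq q h).limsup_eq.symm

lemma one_mem_procPolar (hD : ∀ X ∈ D, S1mem μ T ℱ X) :
    (fun _ _ => 1 : ℝ → Ω → ℝ) ∈ procPolar μ T ℱ D :=
  ⟨PosProc.const zero_le_one, fun X hX => by
    simp only [mul_one]
    exact hD X hX⟩

lemma s1mem_of_mem_bipolar (hD : ∀ X ∈ D, S1mem μ T ℱ X)
    (hX : X ∈ procPolar μ T ℱ (procPolar μ T ℱ D)) : S1mem μ T ℱ X := by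
  have h := hX.2 _ (one_mem_procPolar hD)
  simp only [one_mul] at h
  exact h

lemma bipolar_subset [IsProbabilityMeasure μ] (hT : 0 < T)
    (hrc : ∀ t : ℝ, (ℱ t : MeasurableSpace Ω) = ⨅ (s : ℝ) (_ : t < s), ℱ s)
    (htriv : ∀ A : Set Ω, MeasurableSet[ℱ 0] A → μ A = 0 ∨ μ A = 1)
    (hD : ∀ X ∈ D, S1mem μ T ℱ X) (hcl : FatouClosed μ T ℱ D) (hF : ForkConvex μ T ℱ D)
    (hS : ProcSolid μ T ℱ D) (hfar : FarReaching μ T D) :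
    procPolar μ T ℱ (procPolar μ T ℱ D) ⊆ D := by
  intro X hX
  obtain ⟨Ys, hYs, hpos⟩ := hfar
  have hX' := (s1mem_of_mem_bipolar hD hX).1
  have happrox := fun n : ℕ => exists_mem_approx hT hrc htriv hD hF hS hYs hpos hX hX'
    (τ := grid T n) (by simp [grid, hT.le]) (grid_mono T n) (fun j => (grid_mem hT.le n j).2)
    (⌈T⌉₊ * 2 ^ n) (ε := 2⁻¹ ^ n) (ENNReal.pow_pos (by simp) n)
  choose Y hY hYX using happrox
  have hconv : ∀ q ∈ Icc 0 T, (∃ n₀, ∀ n ≥ n₀, ∃ j ≤ ⌈T⌉₊ * 2 ^ n, grid T n j = q) →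
      ∀ᵐ ω ∂μ, Tendsto (fun n => Y n q ω) atTop (𝓝 (X q ω)) := by
    rintro q hqI ⟨n₀, hn₀⟩
    refine ae_tendsto_of_lintegral_sub_le (n₀ := n₀) (fun n => (hD _ (hY n)).1.1.measurable' hqI)
      (hX.1.measurable' hqI) (fun n hn => ?_) fun n hn => ?_
    all_goals obtain ⟨j, hj, rfl⟩ := hn₀ n hn
    exacts [(hYX n j hj).1, (hYX n j hj).2]
  refine hcl Y X hY hX.1 (fatouConv_of_tendsto hT hX.1 ?_)
  rintro q (hq | rfl)
  · obtain ⟨n₀, hn₀⟩ := dyadic_exists_grid hq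
    obtain ⟨⟨n, j, rfl⟩, hqT⟩ := hq
    refine hconv _ ⟨by positivity, hqT.le⟩ ⟨n₀, fun n hn => ?_⟩
    obtain ⟨j, hj, h⟩ := hn₀ n hn
    exact ⟨j, hj.le, h⟩
  · refine hconv _ ⟨hT.le, le_rfl⟩ ⟨0, fun n _ => ⟨_, le_rfl, min_eq_right ?_⟩⟩
    push_cast
    rw [mul_div_cancel_right₀ _ (by positivity)]
    exact Nat.le_ceil q

end Minimality

/-- **Filtered Bipolar Theorem.** For a far-reaching `C ⊆ S₁`, the process bipolar
`C^×× = (C^×)^×` is the smallest Fatou-closed, fork-convex and (process) solid subset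
of `S₁` containing `C`. -/
theorem filtered_bipolar {m0 : MeasurableSpace Ω} (μ : Measure Ω)
    [IsProbabilityMeasure μ] (T : ℝ) (hT : 0 < T) (ℱ : Filtration ℝ m0)
    (hrc : ∀ t : ℝ, (ℱ t : MeasurableSpace Ω) = ⨅ (s : ℝ) (_ : t < s), ℱ s)
    (hcomp : ∀ A : Set Ω, μ A = 0 → MeasurableSet[ℱ 0] A)
    (htriv : ∀ A : Set Ω, MeasurableSet[ℱ 0] A → μ A = 0 ∨ μ A = 1)
    (C : Set (ℝ → Ω → ℝ)) (hC : ∀ X ∈ C, S1mem μ T ℱ X) (hfar : FarReaching μ T C) :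
    (∀ X ∈ procPolar μ T ℱ (procPolar μ T ℱ C), S1mem μ T ℱ X) ∧
    FatouClosed μ T ℱ (procPolar μ T ℱ (procPolar μ T ℱ C)) ∧
    ForkConvex μ T ℱ (procPolar μ T ℱ (procPolar μ T ℱ C)) ∧
    ProcSolid μ T ℱ (procPolar μ T ℱ (procPolar μ T ℱ C)) ∧
    C ⊆ procPolar μ T ℱ (procPolar μ T ℱ C) ∧
    ∀ D : Set (ℝ → Ω → ℝ), (∀ X ∈ D, S1mem μ T ℱ X) → FatouClosed μ T ℱ D →
      ForkConvex μ T ℱ D → ProcSolid μ T ℱ D → C ⊆ D →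
        procPolar μ T ℱ (procPolar μ T ℱ C) ⊆ D := by
  have hP : ∀ X ∈ procPolar μ T ℱ C, PosProc μ T ℱ X := fun X hX => hX.1
  refine ⟨fun X hX => s1mem_of_mem_bipolar hC hX, fatouClosed_procPolar hT hP,
    forkConvex_procPolar hT hP, procSolid_procPolar hT hP,
    subset_procPolar_procPolar fun X hX => (hC X hX).1.1, fun D hD hcl hF hS hCD => ?_⟩
  obtain ⟨Y, hY, hpos⟩ := hfar
  exact (procPolar_anti (procPolar_anti hCD)).trans
    (bipolar_subset hT hrc htriv hD hcl hF hS ⟨Y, hCD hY, hpos⟩)
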